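/- (Unisolvence of the minimal set.) Let n ≥ 1, 0 ≤ k ≤ n and r ≥ 1, and set N := binom(r+k−1, k)·binom(n+r, n−k). The linear map P_r^− Λ^k(T) → ℝ^N sending ω to the vector of weights (∫_{s_{(α,σ)}} ω) indexed by pairs (σ, α) with σ ∈ S_k^n and α ∈ I_σ, is a linear isomorphism; equivalently, the minimal set X_{r,min}^k(T) of small k-simplices induces unisolvent weights for P_r^− Λ^k(T). -/

import Mathlib

open MeasureTheory Matrix

noncomputable section

/-- A differential `k`-form on `ℝⁿ`, recorded via its pointwise evaluation on `k`-tuples of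
vectors: `ω x (u 0, …, u (k-1)) : ℝ`. -/
abbrev Form (n k : ℕ) : Type := (Fin n → ℝ) → (Fin k → (Fin n → ℝ)) → ℝ

/-- `ω` is a polynomial differential form: all coefficient functions are polynomial. -/
def IsPolyForm {n k : ℕ} (ω : Form n k) : Prop :=
  ∀ u : Fin k → (Fin n → ℝ), ∃ p : MvPolynomial (Fin n) ℝ,
    ∀ x, ω x u = MvPolynomial.eval x p

/-- `ω` is a polynomial differential form of degree at most `r`. -/
def IsPolyFormDeg {n k : ℕ} (r : ℕ) (ω : Form n k) : Prop :=
  ∀ u : Fin k → (Fin n → ℝ), ∃ p : MvPolynomial (Fin n) ℝ,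
    p.totalDegree ≤ r ∧ ∀ x, ω x u = MvPolynomial.eval x p

/-- `ω` is a continuous differential form. -/
def ContinuousForm {n k : ℕ} (ω : Form n k) : Prop :=
  ∀ u : Fin k → (Fin n → ℝ), Continuous fun x => ω x u

/-- The standard `k`-simplex `Δᵏ = {x ∈ ℝᵏ : xⱼ ≥ 0, Σⱼ xⱼ ≤ 1}`. -/
def stdSimplexSet (k : ℕ) : Set (Fin k → ℝ) :=
  {x | (∀ j, 0 ≤ x j) ∧ ∑ j, x j ≤ 1}

/-- Integral of the `k`-form `ω` over the affine `k`-simplex with ordered vertices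
`p 0, …, p k`:  `∫_{Δᵏ} ω(p₀ + Σⱼ xⱼ (pⱼ − p₀))(p₁ − p₀, …, p_k − p₀) dx`. -/
def simpIntegral {n k : ℕ} (ω : Form n k) (p : Fin (k + 1) → (Fin n → ℝ)) : ℝ :=
  ∫ x in stdSimplexSet k,
    ω (p 0 + ∑ j : Fin k, x j • (p j.succ - p 0)) (fun j => p j.succ - p 0)

/-- The Whitney form `ω_σ = Σᵢ (−1)ⁱ λ_{σ(i)} dλ_{σ(0)} ∧ … ∧ ω̂ᵢ ∧ … ∧ dλ_{σ(k)}`, where the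
wedge of the (constant) differentials `dλⱼ` is evaluated as a determinant. -/
def whitney {n k : ℕ} (lam : Fin (n + 1) → ((Fin n → ℝ) →ᵃ[ℝ] ℝ))
    (σ : Fin (k + 1) → Fin (n + 1)) : Form n k :=
  fun x u => ∑ i : Fin (k + 1), (-1 : ℝ) ^ (i : ℕ) * lam (σ i) x *
    Matrix.det (Matrix.of fun a b : Fin k => (lam (σ (i.succAbove a))).linear (u b))

/-- `λ^α ω_σ`, the Whitney form scaled by the barycentric monomial `λ^α`. -/
def scaledWhitney {n k : ℕ} (lam : Fin (n + 1) → ((Fin n → ℝ) →ᵃ[ℝ] ℝ))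
    (α : Fin (n + 1) → ℕ) (σ : Fin (k + 1) → Fin (n + 1)) : Form n k :=
  fun x u => (∏ i, lam i x ^ α i) * whitney lam σ x u

/-- The space `P_r^- Λ^k(T)`: the span of `p · ω_σ` for `p` a polynomial of degree `≤ r − 1`
and `σ` strictly increasing. -/
def PrMinus (n k r : ℕ) (lam : Fin (n + 1) → ((Fin n → ℝ) →ᵃ[ℝ] ℝ)) :
    Submodule ℝ (Form n k) :=
  Submodule.span ℝ {η : Form n k | ∃ (p : MvPolynomial (Fin n) ℝ)
    (σ : Fin (k + 1) → Fin (n + 1)), StrictMono σ ∧ p.totalDegree ≤ r - 1 ∧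
    η = fun x u => MvPolynomial.eval x p * whitney lam σ x u}

/-- The small `k`-simplex `s_{(α,σ)}`, given by its ordered vertices
`(v_{σ(j)} + Σᵢ αᵢ vᵢ)/r`. -/
def smallSimplex {n k : ℕ} (v : Fin (n + 1) → (Fin n → ℝ)) (r : ℕ)
    (σ : Fin (k + 1) → Fin (n + 1)) (α : Fin (n + 1) → ℕ) :
    Fin (k + 1) → (Fin n → ℝ) :=
  fun j => (r : ℝ)⁻¹ • (v (σ j) + ∑ i, (α i : ℝ) • v i)

/-- The index set of the minimal set `X_{r,min}^k(T)`: pairs `(σ, α)` with `σ` strictly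
increasing, `|α| = r − 1` and `αᵢ = 0` for every `i < σ(0)`. -/
def MinIdx (n k r : ℕ) : Type :=
  {q : (Fin (k + 1) → Fin (n + 1)) × (Fin (n + 1) → ℕ) //
    StrictMono q.1 ∧ (∑ i, q.2 i) = r - 1 ∧ ∀ i, i < q.1 0 → q.2 i = 0}

/-- The interpolation operator `Π ω = Σᵢ (∫_{sᵢ} ω) ω_{sᵢ}` built from a dual family `ωs`. -/
def lagrangeProj {n k N : ℕ} (s : Fin N → Fin (k + 1) → (Fin n → ℝ))
    (ωs : Fin N → Form n k) (ω : Form n k) : Form n k :=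
  fun x u => ∑ i, simpIntegral ω (s i) * ωs i x u

/-- Least squares error functional `Σᵢ (∫_{sᵢ} (η − ω))²`. -/
def lsError {n k M : ℕ} (s : Fin M → Fin (k + 1) → (Fin n → ℝ))
    (ω η : Form n k) : ℝ :=
  ∑ i, (simpIntegral (η - ω) (s i)) ^ 2

lemma isCompact_sS (k : ℕ) : IsCompact (stdSimplexSet k) := by
  have hc : IsClosed (stdSimplexSet k) := by
    have : stdSimplexSet k = (⋂ j, {x : Fin k → ℝ | 0 ≤ x j}) ∩ {x | ∑ j, x j ≤ 1} := by
      ext x; simp [stdSimplexSet]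
    rw [this]
    refine IsClosed.inter (isClosed_iInter fun j => isClosed_le (by fun_prop) (by fun_prop))
      (isClosed_le (by fun_prop) (by fun_prop))
  refine (isCompact_univ_pi (fun _ : Fin k => isCompact_Icc (a := (0:ℝ)) (b := 1))).of_isClosed_subset hc ?_
  intro x hx j _
  refine ⟨hx.1 j, le_trans ?_ hx.2⟩
  exact Finset.single_le_sum (f := x) (fun i _ => hx.1 i) (Finset.mem_univ j)

lemma measurableSet_sS (k : ℕ) : MeasurableSet (stdSimplexSet k) :=
  (isCompact_sS k).measurableSet

lemma integrableOn_sS {k : ℕ} {f : (Fin k → ℝ) → ℝ} (hf : Continuous f) :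
    IntegrableOn f (stdSimplexSet k) :=
  hf.continuousOn.integrableOn_compact (isCompact_sS k)

lemma integral_perm_sS {k : ℕ} (σ : Equiv.Perm (Fin k)) (f : (Fin k → ℝ) → ℝ) :
    ∫ s in stdSimplexSet k, f (fun j => s (σ j)) = ∫ s in stdSimplexSet k, f s := by
  have h := volume_measurePreserving_piCongrLeft (fun _ : Fin k => ℝ) σ.symm
  have h2 := h.setIntegral_preimage_emb (MeasurableEquiv.measurableEmbedding _) f (stdSimplexSet k)
  rw [← h2]
  have key : ∀ s : Fin k → ℝ, (MeasurableEquiv.piCongrLeft (fun _ : Fin k => ℝ) σ.symm) s = fun j => s (σ j) := by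
    intro s; ext j
    have := Equiv.piCongrLeft_apply_apply (fun _ : Fin k => ℝ) σ.symm s (σ j)
    simp only [Equiv.symm_apply_apply] at this
    exact this
  have : (MeasurableEquiv.piCongrLeft (fun _ : Fin k => ℝ) σ.symm) ⁻¹' stdSimplexSet k = stdSimplexSet k := by
    ext s
    rw [Set.mem_preimage, key]
    simp only [stdSimplexSet, Set.mem_ofPred_eq]
    rw [Equiv.sum_comp σ s]
    constructor
    · rintro ⟨h, h'⟩; exact ⟨fun j => by simpa using h (σ.symm j), h'⟩
    · rintro ⟨h, h'⟩; exact ⟨fun j => h _, h'⟩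
  rw [this]
  simp_rw [key]

def openSx (k : ℕ) : Set (Fin k → ℝ) := {x | (∀ j, 0 < x j) ∧ ∑ j, x j < 1}

lemma openSx_subset (k : ℕ) : openSx k ⊆ stdSimplexSet k :=
  fun _ hx => ⟨fun j => (hx.1 j).le, hx.2.le⟩

lemma volume_openSx_pos (k : ℕ) : 0 < volume (openSx k) := by
  have ho : IsOpen (openSx k) := by
    have : openSx k = (⋂ j, {x : Fin k → ℝ | 0 < x j}) ∩ {x | ∑ j, x j < 1} := by
      ext x; simp [openSx]
    rw [this]
    exact (isOpen_iInter_of_finite fun j => isOpen_lt (by fun_prop) (by fun_prop)).inter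
      (isOpen_lt (by fun_prop) (by fun_prop))
  refine ho.measure_pos volume ⟨fun _ => 1 / (k + 1), fun j => by positivity, ?_⟩
  simp
  rw [mul_inv_lt_iff₀ (by positivity)]; linarith

/-- positivity of the integral -/
lemma integral_sS_pos {k : ℕ} {f : (Fin k → ℝ) → ℝ} (hf : Continuous f)
    (h0 : ∀ s ∈ stdSimplexSet k, 0 ≤ f s) (h1 : ∀ s ∈ openSx k, 0 < f s) :
    0 < ∫ s in stdSimplexSet k, f s := by
  rw [setIntegral_pos_iff_support_of_nonneg_ae]
  · refine lt_of_lt_of_le (volume_openSx_pos k) (measure_mono fun s hs => ⟨?_, openSx_subset k hs⟩)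
    exact (h1 s hs).ne'
  · exact (ae_restrict_mem (measurableSet_sS k)).mono fun s hs => h0 s hs
  · exact integrableOn_sS hf

def av (k : ℕ) (f : ℝ → ℝ) (L : ℝ) : ℝ := ∫ s in stdSimplexSet k, f (L + ∑ j, s j)

lemma av_root_aux {k : ℕ} (hk : 1 ≤ k) {f : ℝ → ℝ} (hf : Continuous f) (L : ℝ)
    (hpos : ∀ x ∈ Set.Ioo L (L + 1), 0 < f x) : 0 < av k f L := by
  have hcl : ∀ x ∈ Set.Icc L (L + 1), 0 ≤ f x := by
    intro x hx
    rw [← closure_Ioo (by linarith : L ≠ L + 1)] at hx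
    have : closure (Set.Ioo L (L+1)) ⊆ {x | 0 ≤ f x} :=
      closure_minimal (fun y hy => (hpos y hy).le) (isClosed_le continuous_const hf)
    exact this hx
  refine integral_sS_pos (by fun_prop) ?_ ?_
  · intro s hs
    apply hcl
    exact ⟨by linarith [Finset.sum_nonneg (fun j (_ : j ∈ Finset.univ) => hs.1 j)], by linarith [hs.2]⟩
  · intro s hs
    apply hpos
    have : 0 < ∑ j, s j := Finset.sum_pos (fun j _ => hs.1 j) ⟨⟨0, hk⟩, Finset.mem_univ _⟩
    exact ⟨by linarith, by linarith [hs.2]⟩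

lemma av_root {k : ℕ} (hk : 1 ≤ k) {f : ℝ → ℝ} (hf : Continuous f) (L : ℝ)
    (h : av k f L = 0) : ∃ ξ ∈ Set.Ioo L (L + 1), f ξ = 0 := by
  by_contra! hne
  have hpre : IsPreconnected (Set.Ioo L (L + 1)) := isPreconnected_Ioo
  have hmid : L + 1/2 ∈ Set.Ioo L (L+1) := ⟨by linarith, by linarith⟩
  have hsign : (∀ x ∈ Set.Ioo L (L+1), 0 < f x) ∨ (∀ x ∈ Set.Ioo L (L+1), 0 < - f x) := by
    rcases lt_or_gt_of_ne (hne _ hmid) with h1 | h1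
    · right; intro x hx
      by_contra hc
      have : (0:ℝ) ∈ f '' Set.Ioo L (L+1) := hpre.intermediate_value hmid hx hf.continuousOn ⟨h1.le, by linarith⟩
      obtain ⟨y, hy, hy0⟩ := this
      exact hne y hy hy0
    · left; intro x hx
      by_contra hc
      have : (0:ℝ) ∈ f '' Set.Ioo L (L+1) := hpre.intermediate_value hx hmid hf.continuousOn ⟨by linarith, h1.le⟩
      obtain ⟨y, hy, hy0⟩ := this
      exact hne y hy hy0
  rcases hsign with hs | hs
  · exact (av_root_aux hk hf L hs).ne' h
  · have := av_root_aux hk hf.neg L hs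
    have h2 : av k (fun x => - f x) L = - av k f L := by
      simp [av, integral_neg]
    change 0 < av k (fun x => - f x) L at this
    rw [h2, h] at this; simp at this

lemma poly_factor {f : Polynomial ℝ} {M : ℕ} (hd : f.natDegree ≤ M) (ξ : ℕ → ℝ)
    (hinj : Set.InjOn ξ (Finset.range M : Set ℕ)) (hr : ∀ i < M, f.eval (ξ i) = 0) :
    f = Polynomial.C (f.coeff M) * ∏ i ∈ Finset.range M, (Polynomial.X - Polynomial.C (ξ i)) := by
  rw [← sub_eq_zero]
  have hm : (∏ i ∈ Finset.range M, (Polynomial.X - Polynomial.C (ξ i))).Monic :=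
    Polynomial.monic_prod_of_monic _ _ fun i _ => Polynomial.monic_X_sub_C _
  have hdeg : (∏ i ∈ Finset.range M, (Polynomial.X - Polynomial.C (ξ i))).natDegree = M := by
    rw [Polynomial.natDegree_prod_of_monic _ _ fun i _ => Polynomial.monic_X_sub_C _]
    simp
  refine Polynomial.eq_zero_of_degree_lt_of_eval_index_eq_zero (v := ξ) _ hinj ?_ ?_
  · rw [Finset.card_range, Polynomial.degree_lt_iff_coeff_zero]
    intro m hm'
    rcases eq_or_lt_of_le hm' with rfl | hlt
    · have : (∏ i ∈ Finset.range M, (Polynomial.X - Polynomial.C (ξ i))).coeff M = 1 := by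
        conv_lhs => rw [← hdeg]
        rw [hdeg]
        have := hm.coeff_natDegree
        rwa [hdeg] at this
      simp [this]
    · rw [Polynomial.coeff_sub, Polynomial.coeff_C_mul, Polynomial.coeff_eq_zero_of_natDegree_lt (by omega),
        Polynomial.coeff_eq_zero_of_natDegree_lt (p := ∏ i ∈ _, _) (by omega)]
      simp
  · intro i hi
    have hi' := Finset.mem_range.1 hi
    simp only [Polynomial.eval_sub, hr i hi', Polynomial.eval_mul, Polynomial.eval_prod]
    rw [Finset.prod_eq_zero hi (by simp)]; simp

lemma av_factor {k : ℕ} (hk : 1 ≤ k) {f : Polynomial ℝ} {M : ℕ} (hd : f.natDegree ≤ M) (δ : ℝ)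
    (h : ∀ i < M, av k (fun t => f.eval t) (δ - 1 - i) = 0) :
    ∃ ξ : ℕ → ℝ, (∀ i < M, ξ i ∈ Set.Ioo (δ - 1 - i) (δ - i)) ∧
      f = Polynomial.C (f.coeff M) * ∏ i ∈ Finset.range M, (Polynomial.X - Polynomial.C (ξ i)) := by
  have : ∀ i : ℕ, ∃ x : ℝ, i < M → x ∈ Set.Ioo (δ - 1 - i) (δ - i) ∧ f.eval x = 0 := by
    intro i
    by_cases hi : i < M
    · obtain ⟨x, hx, hx0⟩ := av_root hk f.continuous _ (h i hi)
      exact ⟨x, fun _ => ⟨⟨hx.1, by linarith [hx.2]⟩, hx0⟩⟩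
    · exact ⟨0, fun h => absurd h hi⟩
  choose ξ hξ using this
  refine ⟨ξ, fun i hi => (hξ i hi).1, poly_factor hd ξ ?_ fun i hi => (hξ i hi).2⟩
  intro i hi j hj hij
  have hi' := hξ i (by simpa using hi)
  have hj' := hξ j (by simpa using hj)
  have h1 := hi'.1; have h2 := hj'.1
  rw [hij] at h1
  have e1 : (i:ℝ) < j + 1 := by linarith [h1.1, h1.2, h2.1, h2.2]
  have e2 : (j:ℝ) < i + 1 := by linarith [h1.1, h1.2, h2.1, h2.2]
  have e1' : i < j + 1 := by exact_mod_cast e1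
  have e2' : j < i + 1 := by exact_mod_cast e2
  omega

lemma av_R1 {k : ℕ} (hk : 1 ≤ k) {f : Polynomial ℝ} {M : ℕ} (hd : f.natDegree ≤ M)
    (h : ∀ i < M, av k (fun t => f.eval t) (- 1 - i) = 0) :
    (f.coeff M = 0 → f = 0) ∧ ∃ c > 0, f.eval 0 = c * f.coeff M := by
  obtain ⟨ξ, hξ, hf⟩ := av_factor hk hd 0 (by simpa using h)
  refine ⟨fun h0 => by rw [hf, h0]; simp, ∏ i ∈ Finset.range M, (0 - ξ i), Finset.prod_pos ?_, ?_⟩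
  · intro i hi
    have := (hξ i (by simpa using hi)).2
    have : (0:ℝ) ≤ i := by positivity
    linarith
  · conv_lhs => rw [hf]
    simp [Polynomial.eval_prod, mul_comm]

lemma av_R1_zero {k : ℕ} (hk : 1 ≤ k) {f : Polynomial ℝ} {M : ℕ} (hd : f.natDegree ≤ M)
    (h : ∀ i < M, av k (fun t => f.eval t) (- 1 - i) = 0) (h0 : f.eval 0 = 0) : f = 0 := by
  obtain ⟨h1, c, hc, h2⟩ := av_R1 hk hd h
  apply h1
  rw [h0] at h2
  rcases mul_eq_zero.1 h2.symm with h | h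
  · exact absurd h hc.ne'
  · exact h

lemma av_R2 {k : ℕ} (hk : 1 ≤ k) {f : Polynomial ℝ} {M : ℕ} (hd : f.natDegree ≤ M + 1)
    (h : ∀ i < M + 1, av k (fun t => f.eval t) (- i) = 0) :
    ∃ c > 0, f.eval 0 = - c * f.coeff (M + 1) := by
  obtain ⟨ξ, hξ, hf⟩ := av_factor hk hd 1 (by simpa using h)
  refine ⟨(∏ i ∈ Finset.range M, (0 - ξ (i+1))) * ξ 0, mul_pos (Finset.prod_pos ?_) ?_, ?_⟩
  · intro i hi
    have := (hξ (i+1) (by simpa using hi)).2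
    push_cast at this
    have : (0:ℝ) ≤ i := by positivity
    linarith
  · have := (hξ 0 (by simp)).1
    simpa using this
  · conv_lhs => rw [hf]
    simp [Polynomial.eval_prod, Finset.prod_range_succ']
    ring

def mu (k i : ℕ) : ℝ := ∫ s in stdSimplexSet k, (∑ j, s j) ^ i

lemma mu_zero_pos (k : ℕ) : 0 < mu k 0 := by
  unfold mu
  exact integral_sS_pos (by fun_prop) (fun s _ => by simp) (fun s _ => by simp)

open Polynomial in
lemma av_exists (k : ℕ) {f : ℝ[X]} {N : ℕ} (hd : f.natDegree ≤ N) :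
    ∃ g : ℝ[X], g.natDegree ≤ N ∧ g.coeff N = mu k 0 * f.coeff N ∧
      ∀ L, av k (fun t => f.eval t) L = g.eval L := by
  refine ⟨∑ i ∈ Finset.range (N + 1), C (mu k i) * hasseDeriv i f, ?_, ?_, ?_⟩
  · refine natDegree_sum_le_of_forall_le _ _ fun i _ => ?_
    refine (natDegree_C_mul_le _ _).trans ((natDegree_hasseDeriv_le _ _).trans ?_)
    omega
  · rw [finsetSum_coeff, Finset.sum_eq_single 0]
    · simp
    · intro i _ hi
      rw [coeff_C_mul, hasseDeriv_coeff, coeff_eq_zero_of_natDegree_lt (by omega)]; simp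
    · simp
  · intro L
    have : ∀ t, f.eval (L + t) = ∑ i ∈ Finset.range (N + 1), (hasseDeriv i f).eval L * t ^ i := by
      intro t
      rw [add_comm, ← taylor_eval, eval_eq_sum_range' (n := N + 1) (by rw [natDegree_taylor]; omega)]
      simp [taylor_coeff]
    unfold av
    simp_rw [this]
    rw [integral_finsetSum _ (fun i _ => integrableOn_sS (by fun_prop))]
    rw [eval_finsetSum]
    refine Finset.sum_congr rfl fun i _ => ?_
    rw [integral_const_mul]; simp [mu, mul_comm]

lemma av_congr_sub {k : ℕ} (f g : Polynomial ℝ) (L : ℝ) :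
    av k (fun t => (f - g).eval t) L = av k (fun t => f.eval t) L - av k (fun t => g.eval t) L := by
  unfold av
  rw [← integral_sub (integrableOn_sS (by fun_prop)) (integrableOn_sS (by fun_prop))]
  simp

lemma av_congr_add {k : ℕ} (f g : Polynomial ℝ) (L : ℝ) :
    av k (fun t => (f + g).eval t) L = av k (fun t => f.eval t) L + av k (fun t => g.eval t) L := by
  unfold av
  rw [← integral_add (integrableOn_sS (by fun_prop)) (integrableOn_sS (by fun_prop))]
  simp

lemma av_congr_C {k : ℕ} (c : ℝ) (f : Polynomial ℝ) (L : ℝ) :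
    av k (fun t => (Polynomial.C c * f).eval t) L = c * av k (fun t => f.eval t) L := by
  unfold av
  rw [← integral_const_mul]
  simp

open Polynomial in
lemma av_surj (k : ℕ) (N : ℕ) : ∀ (g : ℝ[X]), g.natDegree ≤ N →
    ∃ f : ℝ[X], f.natDegree ≤ N ∧ g.coeff N = mu k 0 * f.coeff N ∧
      ∀ L, av k (fun t => f.eval t) L = g.eval L := by
  suffices h : ∀ (N : ℕ) (g : ℝ[X]), g.degree < N → ∃ f : ℝ[X], f.degree < N ∧
      ∀ L, av k (fun t => f.eval t) L = g.eval L by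
    intro g hg
    obtain ⟨f, hf, hfg⟩ := h (N + 1) g (by
      rw [degree_lt_iff_coeff_zero]; intro m hm; exact coeff_eq_zero_of_natDegree_lt (by omega))
    have hfd : f.natDegree ≤ N := by
      rw [degree_lt_iff_coeff_zero] at hf
      exact natDegree_le_iff_coeff_eq_zero.2 fun m hm => hf m (by omega)
    obtain ⟨g', h1, h2, h3⟩ := av_exists k hfd
    have : g = g' := Polynomial.funext fun L => by rw [← hfg, h3]
    exact ⟨f, hfd, by rw [this, h2], hfg⟩
  intro N
  induction N with
  | zero =>
    intro g hg
    have : g = 0 := by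
      rw [← degree_eq_bot]; simpa using hg
    refine ⟨0, by simp, fun L => by simp [this, av]⟩
  | succ N ih =>
    intro g hg
    rw [degree_lt_iff_coeff_zero] at hg
    obtain ⟨p, h1, h2, h3⟩ := av_exists k (f := C (g.coeff N / mu k 0) * X ^ N) (N := N)
      (natDegree_C_mul_X_pow_le _ _)
    have hmu := (mu_zero_pos k).ne'
    obtain ⟨f, hf, hfg⟩ := ih (g - p) (by
      rw [degree_lt_iff_coeff_zero]
      intro m hm
      rcases eq_or_lt_of_le hm with rfl | hlt
      · rw [coeff_sub, h2, coeff_C_mul, coeff_X_pow]; simp; field_simp; simp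
      · rw [coeff_sub, hg m (by omega), coeff_eq_zero_of_natDegree_lt (by omega : p.natDegree < m)]; simp)
    refine ⟨f + C (g.coeff N / mu k 0) * X ^ N, ?_, fun L => ?_⟩
    · rw [degree_lt_iff_coeff_zero] at hf ⊢
      intro m hm
      rw [coeff_add, hf m (by omega), coeff_C_mul, coeff_X_pow]
      simp; omega
    · rw [av_congr_add, hfg, h3]; simp

open Polynomial in
lemma av_moment {k : ℕ} (j0 : Fin k) (B : ℝ[X]) (L : ℝ) :
    (k : ℝ) * (∫ s in stdSimplexSet k, s j0 * B.eval (L + ∑ j, s j)) =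
      av k (fun t => (X * B).eval t) L - L * av k (fun t => B.eval t) L := by
  have hsym : ∀ j, ∫ s in stdSimplexSet k, s j * B.eval (L + ∑ j, s j) =
      ∫ s in stdSimplexSet k, s j0 * B.eval (L + ∑ j, s j) := by
    intro j
    rw [← integral_perm_sS (Equiv.swap j0 j) (fun s => s j * B.eval (L + ∑ j, s j))]
    refine integral_congr_ae (Filter.Eventually.of_forall fun s => ?_)
    simp only [Equiv.swap_apply_right]
    rw [Equiv.sum_comp (Equiv.swap j0 j) s]
  have h1 : (k : ℝ) * (∫ s in stdSimplexSet k, s j0 * B.eval (L + ∑ j, s j)) =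
      ∑ j : Fin k, ∫ s in stdSimplexSet k, s j * B.eval (L + ∑ j, s j) := by
    rw [Finset.sum_congr rfl fun j _ => hsym j]; simp
  rw [h1, ← integral_finsetSum _ (fun i _ => integrableOn_sS (by fun_prop))]
  unfold av
  rw [← integral_const_mul, ← integral_sub (integrableOn_sS (by fun_prop)) (integrableOn_sS (by fun_prop))]
  refine integral_congr_ae (Filter.Eventually.of_forall fun s => ?_)
  simp only [eval_mul, eval_X, ← Finset.sum_mul]
  ring

open Polynomial in
lemma oneD {k : ℕ} (j0 : Fin k) (c : ℝ) (hc : 0 ≤ c) {J : ℕ} {A B : ℝ[X]}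
    (hA : A.natDegree ≤ J + 1) (hB : B.natDegree ≤ J)
    (h1 : ∀ i < J, av k (fun t => B.eval t) (- 1 - i) = 0)
    (h2 : ∀ i < J + 1, av k (fun t => A.eval t) (- 1 - i)
      + c * (∫ s in stdSimplexSet k, s j0 * B.eval ((- 1 - i) + ∑ j, s j)) = 0)
    (h3 : A.eval 0 = 0) (h4 : A.coeff (J + 1) + B.coeff J = 0) : B = 0 := by
  have hk : 1 ≤ k := by have := j0.2; omega
  have hk0 : (0:ℝ) < k := by exact_mod_cast hk
  by_contra hne
  have hb : B.coeff J ≠ 0 := fun h => hne ((av_R1 hk hB h1).1 h)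
  obtain ⟨g, hg1, hg2, hg3⟩ := av_exists k hB
  obtain ⟨F, hF1, hF2, hF3⟩ := av_surj k (J + 1) (X * g) (by
    rcases eq_or_ne g 0 with rfl | h
    · simp
    · rw [natDegree_X_mul h]; omega)
  have hmu := (mu_zero_pos k).ne'
  have hFb : F.coeff (J + 1) = B.coeff J := by
    rw [coeff_X_mul, hg2] at hF2
    exact (mul_left_cancel₀ hmu hF2).symm
  obtain ⟨c2, hc2, hF0⟩ := av_R2 (M := J) hk hF1 (by
    intro i hi
    rw [hF3]
    rcases i with _ | i
    · simp
    · have := h1 i (by omega)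
      rw [hg3] at this
      simp only [eval_mul, eval_X]
      push_cast
      rw [show (-((i:ℝ) + 1)) = -1 - i by ring, this]; simp)
  set θ : ℝ[X] := A + C (c / k) * (X * B - F) with hθ
  have hθd : θ.natDegree ≤ J + 1 := by
    refine natDegree_add_le_of_degree_le hA ((natDegree_C_mul_le _ _).trans ?_)
    refine (natDegree_sub_le_of_le (m := J+1) ?_ hF1).trans (by simp)
    exact natDegree_mul_le_of_le (m := 1) natDegree_X_le hB |>.trans (by omega)
  obtain ⟨-, c1, hc1, hθ0⟩ := av_R1 (M := J + 1) hk hθd (by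
    intro i hi
    rw [hθ, av_congr_add, av_congr_C, av_congr_sub, hF3, ← h2 i hi]
    have := av_moment j0 B (-1 - i)
    rw [hg3 (-1 - i)] at this
    have hXg : eval (-1 - (i:ℝ)) (X * g) = (-1 - i) * eval (-1 - (i:ℝ)) g := by simp
    rw [hXg]
    generalize (∫ s in stdSimplexSet k, s j0 * B.eval ((- 1 - i) + ∑ j, s j)) = W at *
    generalize av k (fun t => (X * B).eval t) (-1-i) = V at *
    field_simp
    linear_combination -c * this)
  have e1 : θ.coeff (J + 1) = - B.coeff J := by
    rw [hθ, coeff_add, coeff_C_mul, coeff_sub, coeff_X_mul, hFb]; linarith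
  have e2 : θ.eval 0 = - (c / k) * F.eval 0 := by
    rw [hθ]; simp [h3]
  rw [e1, e2, hF0, hFb] at hθ0
  have : (c / k * c2 + c1) * B.coeff J = 0 := by linear_combination hθ0
  have hpos : 0 < c / k * c2 + c1 := by positivity
  rcases mul_eq_zero.1 this with h | h
  · exact hpos.ne' h
  · exact hb h

section Bpart
set_option linter.unusedSectionVars false
variable {ι : Type*} [Fintype ι] [DecidableEq ι]

lemma fd_weights (c b : ℕ) (hb : b ≤ c) :
    ∑ h ∈ Finset.range (c + 1), ((-1 : ℝ) ^ (c - h) * (c.choose h) / (c.factorial)) * (h : ℝ) ^ b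
      = if b = c then 1 else 0 := by
  have h := fwdDiff_iter_eq_sum_shift (1 : ℝ) (fun x : ℝ => x ^ b) c 0
  have h2 : ∑ h ∈ Finset.range (c + 1), ((-1 : ℝ) ^ (c - h) * (c.choose h) / (c.factorial)) * (h : ℝ) ^ b
      = (fwdDiff (1:ℝ))^[c] (fun x : ℝ => x ^ b) 0 / c.factorial := by
    rw [h, Finset.sum_div]
    refine Finset.sum_congr rfl fun i _ => ?_
    simp
    ring
  rw [h2]
  split_ifs with hbc
  · subst hbc
    rw [fwdDiff_iter_eq_factorial]
    simp [Nat.factorial_ne_zero]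
  · rw [fwdDiff_iter_pow_eq_zero_of_lt (by omega)]
    simp

/-- A functional supported on lattice points extracting a coefficient. -/
lemma exists_coeff_functional (γ : ι →₀ ℕ) : ∃ (S : Finset (ι → ℕ)) (w : (ι → ℕ) → ℝ),
    (∀ η ∈ S, ∑ i, η i ≤ γ.degree) ∧
    ∀ q : MvPolynomial ι ℝ, (∀ β, γ.degree < Finsupp.degree β → q.coeff β = 0) →
      ∑ η ∈ S, w η * MvPolynomial.eval (fun i => (η i : ℝ)) q = q.coeff γ := by
  refine ⟨Fintype.piFinset fun i => Finset.range (γ i + 1),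
    fun η => ∏ i, ((-1 : ℝ) ^ (γ i - η i) * ((γ i).choose (η i)) / ((γ i).factorial)), ?_, ?_⟩
  · intro η hη
    rw [Finsupp.degree_eq_sum]
    refine Finset.sum_le_sum fun i _ => ?_
    have := Fintype.mem_piFinset.1 hη i
    simp at this; omega
  · intro q hq
    have hmon : ∀ β : ι →₀ ℕ, Finsupp.degree β ≤ γ.degree →
        ∑ η ∈ Fintype.piFinset fun i => Finset.range (γ i + 1),
          (∏ i, ((-1 : ℝ) ^ (γ i - η i) * ((γ i).choose (η i)) / ((γ i).factorial))) *
            ∏ i, (η i : ℝ) ^ β i = if β = γ then 1 else 0 := by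
      intro β hβ
      simp_rw [← Finset.prod_mul_distrib]
      rw [← Finset.prod_univ_sum (fun i => Finset.range (γ i + 1))
        (fun i h => ((-1 : ℝ) ^ (γ i - h) * ((γ i).choose h) / ((γ i).factorial)) * (h : ℝ) ^ β i)]
      split_ifs with h
      · subst h
        refine Finset.prod_eq_one fun i _ => ?_
        rw [fd_weights _ _ le_rfl]; simp
      · have : ∃ i, β i < γ i := by
          by_contra! hcon
          apply h
          ext i
          have hs : ∑ i, γ i = ∑ i, β i := by
            apply le_antisymm
            · exact Finset.sum_le_sum fun i _ => hcon i
            · rw [← Finsupp.degree_eq_sum, ← Finsupp.degree_eq_sum]; exact hβ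
          have := (Finset.sum_eq_sum_iff_of_le (fun i _ => hcon i)).1 hs i (Finset.mem_univ i)
          exact this.symm
        obtain ⟨i, hi⟩ := this
        refine Finset.prod_eq_zero (Finset.mem_univ i) ?_
        rw [fd_weights _ _ hi.le, if_neg hi.ne]
    simp_rw [MvPolynomial.eval_eq', Finset.mul_sum]
    rw [Finset.sum_comm]
    have : ∀ β ∈ q.support, ∑ η ∈ Fintype.piFinset fun i => Finset.range (γ i + 1),
        (∏ i, ((-1 : ℝ) ^ (γ i - η i) * ((γ i).choose (η i)) / ((γ i).factorial))) *
            (q.coeff β * ∏ i, (η i : ℝ) ^ β i) = if β = γ then q.coeff β else 0 := by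
      intro β hβ
      have hle : Finsupp.degree β ≤ γ.degree := by
        by_contra hc
        exact (MvPolynomial.mem_support_iff.1 hβ) (hq β (by omega))
      have h := hmon β hle
      have h' := congrArg (fun z => q.coeff β * z) h
      simp only [Finset.mul_sum] at h'
      rw [mul_ite, mul_one, mul_zero] at h'
      rw [← h']
      refine Finset.sum_congr rfl fun η _ => by ring
    rw [Finset.sum_congr rfl this, Finset.sum_ite_eq']
    split_ifs with h
    · rfl
    · simpa using (MvPolynomial.notMem_support_iff.1 h).symm

/-- translation -/
def tr (h : ι → ℝ) : MvPolynomial ι ℝ →ₐ[ℝ] MvPolynomial ι ℝ :=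
  MvPolynomial.aeval fun i => MvPolynomial.X i + MvPolynomial.C (h i)

lemma eval_tr (h x : ι → ℝ) (q : MvPolynomial ι ℝ) :
    MvPolynomial.eval x (tr h q) = MvPolynomial.eval (fun i => x i + h i) q := by
  induction q using MvPolynomial.induction_on with
  | C a => simp [tr]
  | add p q hp hq => simp [hp, hq]
  | mul_X p i hp => simp [hp]; simp [tr]

/-- the second order Taylor remainder -/
def trE (h : ι → ℝ) (q : MvPolynomial ι ℝ) : MvPolynomial ι ℝ :=
  tr h q - q - ∑ i, MvPolynomial.C (h i) * MvPolynomial.pderiv i q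

def TQ (h : ι → ℝ) (d : ℕ) (q : MvPolynomial ι ℝ) : Prop :=
  (∀ β, d < Finsupp.degree β → q.coeff β = 0) ∧
  (∀ β, d ≤ Finsupp.degree β → (tr h q - q).coeff β = 0) ∧
  (∀ β, d ≤ Finsupp.degree β + 1 → (trE h q).coeff β = 0)

lemma TQ_add {h : ι → ℝ} {d : ℕ} {p q : MvPolynomial ι ℝ} (hp : TQ h d p) (hq : TQ h d q) :
    TQ h d (p + q) := by
  refine ⟨fun β hβ => by simp [hp.1 β hβ, hq.1 β hβ], fun β hβ => ?_, fun β hβ => ?_⟩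
  · have : tr h (p + q) - (p + q) = (tr h p - p) + (tr h q - q) := by rw [map_add]; ring
    rw [this, MvPolynomial.coeff_add, hp.2.1 β hβ, hq.2.1 β hβ, add_zero]
  · have : trE h (p + q) = trE h p + trE h q := by
      simp only [trE, map_add, mul_add, Finset.sum_add_distrib]; ring
    rw [this, MvPolynomial.coeff_add, hp.2.2 β hβ, hq.2.2 β hβ, add_zero]

lemma TQ_mono {h : ι → ℝ} {d d' : ℕ} (hd : d ≤ d') {p : MvPolynomial ι ℝ} (hp : TQ h d p) :
    TQ h d' p :=
  ⟨fun β hβ => hp.1 β (by omega), fun β hβ => hp.2.1 β (by omega), fun β hβ => hp.2.2 β (by omega)⟩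

lemma degree_sub_single {γ : ι →₀ ℕ} {i : ι} (hi : i ∈ γ.support) :
    Finsupp.degree (γ - Finsupp.single i 1) + 1 = Finsupp.degree γ := by
  have h : (γ - Finsupp.single i 1) + Finsupp.single i 1 = γ := by
    apply tsub_add_cancel_of_le
    rw [Finsupp.single_le_iff]
    have := Finsupp.mem_support_iff.1 hi
    omega
  conv_rhs => rw [← h]
  rw [map_add, Finsupp.degree_single]

lemma TQ_X {h : ι → ℝ} {d : ℕ} {p : MvPolynomial ι ℝ} (hp : TQ h d p) (i : ι) :
    TQ h (d + 1) (MvPolynomial.X i * p) := by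
  have e1 : tr h (MvPolynomial.X i * p) = (MvPolynomial.X i + MvPolynomial.C (h i)) * tr h p := by
    rw [map_mul]; simp [tr]
  have hX : ∀ (d : ℕ) (q : MvPolynomial ι ℝ), (∀ β, d ≤ Finsupp.degree β → q.coeff β = 0) →
      ∀ β, d + 1 ≤ Finsupp.degree β → (MvPolynomial.X i * q).coeff β = 0 := by
    intro d q hq β hβ
    rw [MvPolynomial.coeff_X_mul']
    split_ifs with hi
    · apply hq
      have := degree_sub_single hi; omega
    · rfl
  refine ⟨fun β hβ => ?_, fun β hβ => ?_, fun β hβ => ?_⟩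
  · exact hX (d + 1) p (fun β hβ => hp.1 β (by omega)) β (by omega)
  · have : tr h (MvPolynomial.X i * p) - MvPolynomial.X i * p =
      MvPolynomial.X i * (tr h p - p) + MvPolynomial.C (h i) * ((tr h p - p) + p) := by
      rw [e1]; ring
    rw [this, MvPolynomial.coeff_add, hX d _ hp.2.1 β hβ, MvPolynomial.coeff_C_mul,
      MvPolynomial.coeff_add, hp.2.1 β (by omega), hp.1 β (by omega)]; simp
  · have : trE h (MvPolynomial.X i * p) =
      MvPolynomial.X i * trE h p + MvPolynomial.C (h i) * (tr h p - p) := by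
      have hs : ∑ j, MvPolynomial.C (h j) * MvPolynomial.pderiv j (MvPolynomial.X i * p) =
          MvPolynomial.C (h i) * p + MvPolynomial.X i * ∑ j, MvPolynomial.C (h j) * MvPolynomial.pderiv j p := by
        simp_rw [MvPolynomial.pderiv_mul, mul_add, Finset.sum_add_distrib, Finset.mul_sum]
        congr 1
        · rw [Finset.sum_eq_single i]
          · simp
          · intro j _ hj
            rw [MvPolynomial.pderiv_X_of_ne hj.symm]; simp
          · simp
        · exact Finset.sum_congr rfl fun j _ => by ring
      simp only [trE]
      rw [hs, e1]; ring
    rw [this, MvPolynomial.coeff_add, MvPolynomial.coeff_C_mul, hp.2.1 β (by omega), mul_zero, add_zero]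
    rw [MvPolynomial.coeff_X_mul']
    split_ifs with hi
    · apply hp.2.2
      have := degree_sub_single hi; omega
    · rfl

lemma TQ_monomial (h : ι → ℝ) (c : ℝ) : ∀ (d : ℕ) (γ : ι →₀ ℕ), γ.degree = d →
    TQ h d (MvPolynomial.monomial γ c) := by
  intro d
  induction d with
  | zero =>
    intro γ hγ
    have : γ = 0 := (Finsupp.degree_eq_zero_iff γ).1 hγ
    subst this
    have hC : (MvPolynomial.monomial (0 : ι →₀ ℕ) c) = MvPolynomial.C c := rfl
    rw [hC]
    refine ⟨fun β hβ => ?_, fun β _ => by simp [tr], fun β _ => by simp [trE, tr]⟩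
    rw [MvPolynomial.coeff_C, if_neg]
    rintro rfl; simp at hβ
  | succ d ih =>
    intro γ hγ
    have : ∃ i, i ∈ γ.support := by
      by_contra! hcon
      have : γ = 0 := by ext i; simpa using hcon i
      subst this; simp at hγ
    obtain ⟨i, hi⟩ := this
    have hd := degree_sub_single hi
    have := TQ_X (ih (γ - Finsupp.single i 1) (by omega)) i
    convert this using 1
    rw [MvPolynomial.X, MvPolynomial.monomial_mul, one_mul]
    congr 2
    rw [add_comm]
    symm
    apply tsub_add_cancel_of_le
    rw [Finsupp.single_le_iff]
    have := Finsupp.mem_support_iff.1 hi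
    omega

lemma TQ_of_deg (h : ι → ℝ) {d : ℕ} {q : MvPolynomial ι ℝ}
    (hq : ∀ β, d < Finsupp.degree β → q.coeff β = 0) : TQ h d q := by
  rw [q.as_sum]
  have hz : TQ h d 0 := by
    refine ⟨fun β hβ => by simp, fun β hβ => by simp, fun β hβ => by simp [trE]⟩
  refine Finset.sum_induction _ (TQ h d) (fun _ _ => TQ_add) hz ?_
  intro β hβ
  refine TQ_mono ?_ (TQ_monomial h _ _ β rfl)
  by_contra hc
  exact MvPolynomial.mem_support_iff.1 hβ (hq β (by omega))

lemma coeff_tr0 (h : ι → ℝ) {d : ℕ} {q : MvPolynomial ι ℝ}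
    (hq : ∀ β, d < Finsupp.degree β → q.coeff β = 0) {β : ι →₀ ℕ} (hβ : d ≤ β.degree) :
    (tr h q).coeff β = q.coeff β := by
  have := (TQ_of_deg h hq).2.1 β hβ
  rwa [MvPolynomial.coeff_sub, sub_eq_zero] at this

lemma coeff_tr1 (h : ι → ℝ) {d : ℕ} {q : MvPolynomial ι ℝ}
    (hq : ∀ β, d < Finsupp.degree β → q.coeff β = 0) {β : ι →₀ ℕ} (hβ : d ≤ β.degree + 1) :
    (tr h q).coeff β = q.coeff β + ∑ i, h i * (MvPolynomial.pderiv i q).coeff β := by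
  have := (TQ_of_deg h hq).2.2 β hβ
  rw [trE, MvPolynomial.coeff_sub, MvPolynomial.coeff_sub, MvPolynomial.coeff_sum] at this
  simp_rw [MvPolynomial.coeff_C_mul] at this
  linarith

/-- evaluation of a polynomial with coefficients in `ℝ[X]` -/
def ev (L : ℝ) (x : ι → ℝ) (p : MvPolynomial ι (Polynomial ℝ)) : ℝ :=
  MvPolynomial.eval x (MvPolynomial.map (Polynomial.evalRingHom L) p)

lemma ev_eq (L : ℝ) (x : ι → ℝ) (p : MvPolynomial ι (Polynomial ℝ)) :
    ev L x p = ∑ γ ∈ p.support, (p.coeff γ).eval L * ∏ i, x i ^ γ i := by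
  rw [ev, MvPolynomial.eval_map, MvPolynomial.eval₂_eq']
  simp

lemma continuous_ev {Z : Type*} [TopologicalSpace Z] {f : Z → ℝ} {g : Z → ι → ℝ} (hf : Continuous f)
    (hg : ∀ i, Continuous fun z => g z i) (p : MvPolynomial ι (Polynomial ℝ)) : Continuous fun z => ev (f z) (g z) p := by
  simp_rw [ev_eq]
  fun_prop

lemma ev_injective {p : MvPolynomial ι (Polynomial ℝ)} (h : ∀ L x, ev L x p = 0) : p = 0 := by
  ext1 γ
  refine Polynomial.funext fun L => ?_
  have : MvPolynomial.map (Polynomial.evalRingHom L) p = 0 :=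
    MvPolynomial.funext fun x => by rw [map_zero]; exact h L x
  have := congrArg (MvPolynomial.coeff γ) this
  simpa [MvPolynomial.coeff_map] using this

/-- Extraction of a coefficient under the integral. -/
lemma integral_coeff_eq_zero {k : ℕ} (γ : ι →₀ ℕ) (q : (Fin k → ℝ) → MvPolynomial ι ℝ)
    (hq : ∀ s β, γ.degree < Finsupp.degree β → (q s).coeff β = 0)
    (hc : ∀ x, Continuous fun s => MvPolynomial.eval x (q s))
    (h : ∀ x : ι → ℕ, ∑ i, x i ≤ γ.degree →
      ∫ s in stdSimplexSet k, MvPolynomial.eval (fun i => (x i : ℝ)) (q s) = 0) :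
    ∫ s in stdSimplexSet k, (q s).coeff γ = 0 := by
  obtain ⟨S, w, hS, hw⟩ := exists_coeff_functional γ
  simp_rw [fun s => (hw (q s) (hq s)).symm]
  rw [integral_finsetSum _ (fun η _ => (integrableOn_sS ((hc _).const_mul _)))]
  refine Finset.sum_eq_zero fun η hη => ?_
  rw [integral_const_mul, h η (hS η hη), mul_zero]

end Bpart

section Bpart2
set_option linter.unusedSectionVars false
variable {ι : Type*} [Fintype ι] [DecidableEq ι]

/-- total degree at most `r` (the variable of the coefficients counting too). -/
def Deg (r : ℕ) (p : MvPolynomial ι (Polynomial ℝ)) : Prop :=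
  ∀ γ j, r < j + Finsupp.degree γ → (p.coeff γ).coeff j = 0

lemma Deg.natDegree_le {r : ℕ} {p : MvPolynomial ι (Polynomial ℝ)} (h : Deg r p) {γ : ι →₀ ℕ} {J : ℕ}
    (hJ : r ≤ J + γ.degree) : (p.coeff γ).natDegree ≤ J :=
  Polynomial.natDegree_le_iff_coeff_eq_zero.2 fun m hm => h γ m (by omega)

/-- the displacement in the `x` variables, for the tuple `(n, t)` -/
def sh {k' : ℕ} (t : Fin k' → ι) (s : Fin (k' + 1) → ℝ) (b : ι) : ℝ :=
  ∑ j : Fin k', if t j = b then s j.succ else 0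

/-- the displacement in the `x` variables, for the tuple `(i, t)` -/
def sh1 {k' : ℕ} (i : ι) (t : Fin k' → ι) (s : Fin (k' + 1) → ℝ) (b : ι) : ℝ :=
  (if i = b then s 0 else 0) + sh t s b

lemma sh_continuous {k' : ℕ} (t : Fin k' → ι) (b : ι) : Continuous fun s => sh t s b := by
  unfold sh
  refine continuous_finsetSum _ fun j _ => ?_
  split_ifs <;> fun_prop

lemma sh1_continuous {k' : ℕ} (i : ι) (t : Fin k' → ι) (b : ι) : Continuous fun s => sh1 i t s b := by
  unfold sh1
  refine Continuous.add ?_ (sh_continuous t b)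
  split_ifs <;> fun_prop

lemma sh_update {k' : ℕ} (i : ι) (t : Fin k' → ι) (j : Fin k') (s : Fin (k' + 1) → ℝ) (b : ι) :
    sh (Function.update t j i) s b = sh t s b - (if t j = b then s j.succ else 0)
      + (if i = b then s j.succ else 0) := by
  unfold sh
  rw [← Finset.add_sum_erase _ _ (Finset.mem_univ j), ← Finset.add_sum_erase Finset.univ _ (Finset.mem_univ j)]
  have : ∑ x ∈ Finset.univ.erase j, (if Function.update t j i x = b then s x.succ else 0) =
      ∑ x ∈ Finset.univ.erase j, (if t x = b then s x.succ else 0) := by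
    refine Finset.sum_congr rfl fun x hx => ?_
    rw [Function.update_of_ne (Finset.ne_of_mem_erase hx)]
  rw [this]; simp; ring

/-- the translated specialised polynomial -/
def qq (L : ℝ) (h : ι → ℝ) (p : MvPolynomial ι (Polynomial ℝ)) : MvPolynomial ι ℝ :=
  tr h (MvPolynomial.map (Polynomial.evalRingHom L) p)

lemma eval_qq (L : ℝ) (h x : ι → ℝ) (p : MvPolynomial ι (Polynomial ℝ)) :
    MvPolynomial.eval x (qq L h p) = ev L (fun i => x i + h i) p := by
  rw [qq, eval_tr, ev]

def xdeg (e : ℕ) (p : MvPolynomial ι (Polynomial ℝ)) : Prop :=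
  ∀ γ, e < Finsupp.degree γ → p.coeff γ = 0

lemma qq_coeff0 (L : ℝ) (h : ι → ℝ) {e : ℕ} {p : MvPolynomial ι (Polynomial ℝ)} (hp : xdeg e p)
    {γ : ι →₀ ℕ} (hγ : e ≤ γ.degree) : (qq L h p).coeff γ = (p.coeff γ).eval L := by
  rw [qq, coeff_tr0 h (d := e) _ hγ, MvPolynomial.coeff_map]
  · rfl
  · intro β hβ; rw [MvPolynomial.coeff_map, hp β hβ, map_zero]

lemma qq_coeff1 (L : ℝ) (h : ι → ℝ) {e : ℕ} {p : MvPolynomial ι (Polynomial ℝ)} (hp : xdeg e p)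
    {γ : ι →₀ ℕ} (hγ : e ≤ γ.degree + 1) : (qq L h p).coeff γ = (p.coeff γ).eval L +
      ∑ i, h i * ((MvPolynomial.pderiv i p).coeff γ).eval L := by
  rw [qq, coeff_tr1 h (d := e) _ hγ, MvPolynomial.coeff_map]
  · simp [MvPolynomial.pderiv_map, MvPolynomial.coeff_map]
  · intro β hβ; rw [MvPolynomial.coeff_map, hp β hβ, map_zero]

lemma continuous_eval_qq {k : ℕ} (L : ℝ) (h : (Fin k → ℝ) → ι → ℝ) (hh : ∀ i, Continuous fun s => h s i)
    (x : ι → ℝ) (p : MvPolynomial ι (Polynomial ℝ)) :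
    Continuous fun s => MvPolynomial.eval x (qq (L + ∑ j, s j) (h s) p) := by
  simp_rw [eval_qq]
  refine continuous_ev (by fun_prop) (fun i => ?_) p
  have := hh i
  fun_prop

/-- Step 1: top coefficients have vanishing averages. -/
lemma top_av {k : ℕ} (L : ℝ) (h : (Fin k → ℝ) → ι → ℝ) (hh : ∀ i, Continuous fun s => h s i)
    {p : MvPolynomial ι (Polynomial ℝ)} {γ : ι →₀ ℕ} (hp : xdeg γ.degree p)
    (H : ∀ x : ι → ℕ, ∑ i, x i ≤ γ.degree →
      ∫ s in stdSimplexSet k, ev (L + ∑ j, s j) (fun b => x b + h s b) p = 0) :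
    av k (fun t => (p.coeff γ).eval t) L = 0 := by
  have := integral_coeff_eq_zero (k := k) γ (fun s => qq (L + ∑ j, s j) (h s) p) ?_ ?_ ?_
  · unfold av
    rw [← this]
    refine integral_congr_ae (Filter.Eventually.of_forall fun s => ?_)
    exact (qq_coeff0 _ _ hp le_rfl).symm
  · intro s β hβ
    rw [qq_coeff0 _ _ hp hβ.le, hp β hβ]; simp
  · intro x; exact continuous_eval_qq L h hh x p
  · intro x hx
    simp_rw [eval_qq]; exact H x hx

lemma coeff_sum_X_mul {R : Type*} [CommRing R] (γ : ι →₀ ℕ) (p : ι → MvPolynomial ι R) :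
    (∑ i, MvPolynomial.X i * p i).coeff γ =
      ∑ i, if i ∈ γ.support then (p i).coeff (γ - Finsupp.single i 1) else 0 := by
  rw [MvPolynomial.coeff_sum]
  simp_rw [MvPolynomial.coeff_X_mul']

lemma coeff_euler {R : Type*} [CommRing R] (γ : ι →₀ ℕ) (p : MvPolynomial ι R) :
    (∑ i, MvPolynomial.X i * MvPolynomial.pderiv i p).coeff γ = (γ.degree : R) * p.coeff γ := by
  rw [coeff_sum_X_mul, Finsupp.degree_eq_sum, Nat.cast_sum, Finset.sum_mul]
  refine Finset.sum_congr rfl fun i _ => ?_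
  split_ifs with hi
  · rw [MvPolynomial.coeff_pderiv]
    have h0 := Finsupp.mem_support_iff.1 hi
    have h : (γ - Finsupp.single i 1) + Finsupp.single i 1 = γ := by
      apply tsub_add_cancel_of_le
      rw [Finsupp.single_le_iff]; omega
    rw [h, mul_comm]
    congr 1
    have : γ i = (γ i - 1) + 1 := by omega
    conv_rhs => rw [this]
    simp
  · rw [Finsupp.notMem_support_iff.1 hi]; simp

lemma av_zero' (k : ℕ) (L : ℝ) : av k (fun t => (0 : Polynomial ℝ).eval t) L = 0 := by simp [av]

lemma av_sum {κ : Type*} (k : ℕ) (S : Finset κ) (f : κ → Polynomial ℝ) (L : ℝ) :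
    av k (fun t => (∑ i ∈ S, f i).eval t) L = ∑ i ∈ S, av k (fun t => (f i).eval t) L := by
  unfold av
  rw [← integral_finsetSum _ (fun i _ => integrableOn_sS (by fun_prop))]
  simp [Polynomial.eval_finsetSum]

lemma int_sym {k : ℕ} (j0 j : Fin k) (B : Polynomial ℝ) (L : ℝ) :
    ∫ s in stdSimplexSet k, s j * B.eval (L + ∑ j, s j) =
      ∫ s in stdSimplexSet k, s j0 * B.eval (L + ∑ j, s j) := by
  rw [← integral_perm_sS (Equiv.swap j0 j) (fun s => s j * B.eval (L + ∑ j, s j))]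
  refine integral_congr_ae (Filter.Eventually.of_forall fun s => ?_)
  simp only [Equiv.swap_apply_right]
  rw [Equiv.sum_comp (Equiv.swap j0 j) s]

/-- first-order part: the identity obtained from three kinds of faces. -/
lemma step3 {k' : ℕ} {e : ℕ} (L : ℝ) (i : ι) (t : Fin k' → ι)
    (a b : MvPolynomial ι (Polynomial ℝ)) (bj : Fin k' → MvPolynomial ι (Polynomial ℝ))
    {γ : ι →₀ ℕ} (hγ : γ.degree + 1 = e)
    (ha : xdeg γ.degree a) (hb : xdeg e b) (hbj : ∀ j, xdeg e (bj j))
    (H1 : ∀ x : ι → ℕ, ∑ i, x i ≤ γ.degree →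
      ∫ s in stdSimplexSet (k' + 1), ev (L + ∑ j, s j) (fun c => x c + sh t s c) b = 0)
    (H1j : ∀ j, ∀ x : ι → ℕ, ∑ i, x i ≤ γ.degree →
      ∫ s in stdSimplexSet (k' + 1), ev (L + ∑ j, s j) (fun c => x c + sh (Function.update t j i) s c) (bj j) = 0)
    (H2 : ∀ x : ι → ℕ, ∑ i, x i ≤ γ.degree →
      ∫ s in stdSimplexSet (k' + 1), ev (L + ∑ j, s j) (fun c => x c + sh1 i t s c) (a + b - ∑ j, bj j) = 0) :
    av (k' + 1) (fun z => (a.coeff γ).eval z) L + ∫ s in stdSimplexSet (k' + 1),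
      s 0 * ((MvPolynomial.pderiv i b).coeff γ - ∑ j, (MvPolynomial.pderiv (t j) (bj j)).coeff γ).eval
        (L + ∑ j, s j) = 0 := by
  have hc1 : ∀ b, Continuous fun s => sh t s b := fun b => sh_continuous t b
  have hc2 : ∀ b, Continuous fun s => sh1 i t s b := fun b => sh1_continuous i t b
  have hc3 : ∀ j b, Continuous fun s => sh (Function.update t j i) s b := fun j b => sh_continuous _ b
  have qadd : ∀ (L : ℝ) (h : ι → ℝ), qq L h (a + b - ∑ j, bj j) = qq L h a + qq L h b - ∑ j, qq L h (bj j) := by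
    intro L h; simp [qq]
  let Q : (Fin (k' + 1) → ℝ) → MvPolynomial ι ℝ := fun s =>
    qq (L + ∑ j, s j) (sh1 i t s) (a + b - ∑ j, bj j) - qq (L + ∑ j, s j) (sh t s) b
      + ∑ j, qq (L + ∑ j, s j) (sh (Function.update t j i) s) (bj j)
  have ha' : xdeg e a := fun β hβ => ha β (by omega)
  have hInt0 := integral_coeff_eq_zero (k := k' + 1) γ Q ?_ ?_ ?_
  · -- compute
    have hQ : ∀ s, (Q s).coeff γ = (a.coeff γ).eval (L + ∑ j, s j) +
        (s 0 * ((MvPolynomial.pderiv i b).coeff γ).eval (L + ∑ j, s j) -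
        ∑ j : Fin k', (s 0 * ((MvPolynomial.pderiv i (bj j)).coeff γ).eval (L + ∑ j, s j) -
          s j.succ * ((MvPolynomial.pderiv i (bj j)).coeff γ).eval (L + ∑ j, s j) +
          s j.succ * ((MvPolynomial.pderiv (t j) (bj j)).coeff γ).eval (L + ∑ j, s j))) := by
      intro s
      simp only [Q, qadd, MvPolynomial.coeff_add, MvPolynomial.coeff_sub, MvPolynomial.coeff_sum]
      rw [qq_coeff0 _ _ ha le_rfl, qq_coeff1 _ _ hb hγ.ge, qq_coeff1 _ _ hb hγ.ge]
      have e1 : ∀ j, (qq (L + ∑ j, s j) (sh1 i t s) (bj j)).coeff γ =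
          (qq (L + ∑ j, s j) (sh (Function.update t j i) s) (bj j)).coeff γ +
          (s 0 * ((MvPolynomial.pderiv i (bj j)).coeff γ).eval (L + ∑ j, s j) -
          s j.succ * ((MvPolynomial.pderiv i (bj j)).coeff γ).eval (L + ∑ j, s j) +
          s j.succ * ((MvPolynomial.pderiv (t j) (bj j)).coeff γ).eval (L + ∑ j, s j)) := by
        intro j
        rw [qq_coeff1 _ _ (hbj j) hγ.ge, qq_coeff1 _ _ (hbj j) hγ.ge]
        simp only [sh_update, sh1, add_mul, sub_mul, Finset.sum_add_distrib, Finset.sum_sub_distrib,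
          ite_mul, zero_mul, Finset.sum_ite_eq, Finset.mem_univ, if_true]
        ring
      simp only [e1, sh1, add_mul, Finset.sum_add_distrib,
          ite_mul, zero_mul, Finset.sum_ite_eq, Finset.mem_univ, if_true]
      ring
    simp_rw [hQ] at hInt0
    have cont : ∀ (j : Fin (k' + 1)) (f : Polynomial ℝ),
        Continuous fun s : Fin (k' + 1) → ℝ => s j * f.eval (L + ∑ j, s j) := by
      intro j f; fun_prop
    rw [integral_add (integrableOn_sS (by fun_prop)) (integrableOn_sS (by fun_prop)),
      integral_sub (integrableOn_sS (by fun_prop)) (integrableOn_sS (by fun_prop)),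
      integral_finsetSum _ (fun i _ => integrableOn_sS (by fun_prop))] at hInt0
    have e2 : ∀ j : Fin k', ∫ s in stdSimplexSet (k' + 1),
        (s 0 * ((MvPolynomial.pderiv i (bj j)).coeff γ).eval (L + ∑ j, s j) -
          s j.succ * ((MvPolynomial.pderiv i (bj j)).coeff γ).eval (L + ∑ j, s j) +
          s j.succ * ((MvPolynomial.pderiv (t j) (bj j)).coeff γ).eval (L + ∑ j, s j)) =
        ∫ s in stdSimplexSet (k' + 1),
          s 0 * ((MvPolynomial.pderiv (t j) (bj j)).coeff γ).eval (L + ∑ j, s j) := by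
      intro j
      rw [integral_add (integrableOn_sS (by fun_prop)) (integrableOn_sS (by fun_prop)),
        integral_sub (integrableOn_sS (by fun_prop)) (integrableOn_sS (by fun_prop)),
        int_sym 0 j.succ, int_sym 0 j.succ]
      ring
    simp_rw [e2] at hInt0
    rw [← hInt0]
    unfold av
    congr 1
    rw [← integral_finsetSum _ (fun i _ => integrableOn_sS (by fun_prop)),
      ← integral_sub (integrableOn_sS (by fun_prop)) (integrableOn_sS (by fun_prop))]
    refine integral_congr_ae (Filter.Eventually.of_forall fun s => ?_)
    simp [Polynomial.eval_finsetSum, mul_sub, Finset.mul_sum]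
  · intro s β hβ
    have hβ' : e ≤ β.degree := by omega
    simp only [Q, qadd, MvPolynomial.coeff_add, MvPolynomial.coeff_sub, MvPolynomial.coeff_sum]
    rw [qq_coeff0 _ _ ha hβ.le, ha β hβ, qq_coeff0 _ _ hb hβ', qq_coeff0 _ _ hb hβ',
      Finset.sum_congr rfl fun j _ => qq_coeff0 _ _ (hbj j) hβ',
      Finset.sum_congr rfl fun j _ => qq_coeff0 _ _ (hbj j) hβ']
    simp
  · intro x
    simp only [Q, map_add, map_sub, map_sum]
    refine ((continuous_eval_qq _ _ hc2 _ _).sub (continuous_eval_qq _ _ hc1 _ _)).add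
      (continuous_finsetSum _ fun j _ => continuous_eval_qq _ _ (hc3 j) _ _)
  · intro x hx
    simp only [Q, map_add, map_sub, map_sum (MvPolynomial.eval _)]
    rw [integral_add, integral_sub, integral_finsetSum]
    · simp_rw [eval_qq]
      rw [H2 x hx, H1 x hx, Finset.sum_eq_zero fun j _ => H1j j x hx]; simp
    · exact fun j _ => integrableOn_sS (continuous_eval_qq _ _ (hc3 j) _ _)
    · exact integrableOn_sS (continuous_eval_qq _ _ hc2 _ _)
    · exact integrableOn_sS (continuous_eval_qq _ _ hc1 _ _)
    · exact integrableOn_sS ((continuous_eval_qq _ _ hc2 _ _).sub (continuous_eval_qq _ _ hc1 _ _))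
    · exact integrableOn_sS (continuous_finsetSum _ fun j _ => continuous_eval_qq _ _ (hc3 j) _ _)

end Bpart2

section Bpart3
set_option linter.unusedSectionVars false
variable {ι : Type*} [Fintype ι] [DecidableEq ι]

open Polynomial in
lemma core {k' r : ℕ} (α : ι → (Fin k' → ι) → MvPolynomial ι ℝ[X])
    (β : (Fin k' → ι) → MvPolynomial ι ℝ[X])
    (hα : ∀ i t, Deg r (α i t)) (hβ : ∀ t, Deg r (β t))
    (k1 : ∀ t j, Deg r (∑ i, MvPolynomial.X i * β (Function.update t j i)))
    (k2 : ∀ t, Deg r (∑ i, MvPolynomial.X i * α i t + MvPolynomial.C X * β t))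
    (htr : ∀ i t γ, ((α i t).coeff γ).eval 0 = 0)
    (F1 : ∀ t (m : ℕ) (x : ι → ℕ), m + 1 + ∑ i, x i ≤ r →
      ∫ s in stdSimplexSet (k' + 1), ev ((-1 - m) + ∑ j, s j) (fun b => x b + sh t s b) (β t) = 0)
    (F2 : ∀ i t (m : ℕ) (x : ι → ℕ), m + 1 + ∑ i, x i ≤ r →
      ∫ s in stdSimplexSet (k' + 1), ev ((-1 - m) + ∑ j, s j) (fun b => x b + sh1 i t s b)
        (α i t + β t - ∑ j, β (Function.update t j i)) = 0) :
    (∀ i t, α i t = 0) ∧ ∀ t, β t = 0 := by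
  have main : ∀ d e : ℕ, e + d = r + 1 → ∀ γ : ι →₀ ℕ, e ≤ γ.degree →
      (∀ i t, (α i t).coeff γ = 0) ∧ (∀ t, (β t).coeff γ = 0) := by
    intro d
    induction d with
    | zero =>
      intro e he γ hγ
      refine ⟨fun i t => ?_, fun t => ?_⟩
      · ext j; exact hα i t γ j (by omega)
      · ext j; exact hβ t γ j (by omega)
    | succ d ih =>
      intro e he
      have ih' := ih (e + 1) (by omega)
      have hxα : ∀ i t, xdeg e (α i t) := fun i t γ hγ => (ih' γ hγ).1 i t
      have hxβ : ∀ t, xdeg e (β t) := fun t γ hγ => (ih' γ hγ).2 t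
      -- here d = r - e = J
      have avβ : ∀ t (γ : ι →₀ ℕ), γ.degree = e → ∀ m < d,
          av (k' + 1) (fun z => ((β t).coeff γ).eval z) (-1 - m) = 0 := by
        intro t γ hγ m hm
        refine top_av (-1 - m) (sh t) (sh_continuous t) (hγ ▸ hxβ t) ?_
        intro x hx
        exact F1 t m x (by omega)
      have hα0 : ∀ (γ : ι →₀ ℕ), γ.degree = e → ∀ i t, (α i t).coeff γ = 0 := by
        intro γ hγ i t
        refine av_R1_zero (k := k' + 1) (M := d) (by omega) ((hα i t).natDegree_le (by omega)) ?_ (htr i t γ)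
        intro m hm
        have h2 := top_av (k := k' + 1) (γ := γ) (-1 - m) (sh1 i t) (sh1_continuous i t)
          (p := α i t + β t - ∑ j, β (Function.update t j i)) ?_ ?_
        · rw [MvPolynomial.coeff_sub, MvPolynomial.coeff_add, MvPolynomial.coeff_sum, av_congr_sub,
            av_congr_add, av_sum, avβ t γ hγ m hm,
            Finset.sum_eq_zero fun j _ => avβ (Function.update t j i) γ hγ m hm] at h2
          simpa using h2
        · intro δ hδ
          rw [MvPolynomial.coeff_sub, MvPolynomial.coeff_add, MvPolynomial.coeff_sum,
            hxα i t δ (by omega), hxβ t δ (by omega), Finset.sum_eq_zero fun j _ => hxβ _ δ (by omega)]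
          simp
        · intro x hx
          exact F2 i t m x (by omega)
      have hxα' : ∀ (γ : ι →₀ ℕ), e ≤ γ.degree → ∀ i t, (α i t).coeff γ = 0 := by
        intro γ hγ i t
        rcases eq_or_lt_of_le hγ with h | h
        · exact hα0 γ h.symm i t
        · exact hxα i t γ h
      -- step 2
      have hY : ∀ t j (γ : ι →₀ ℕ), γ.degree = e + 1 →
          (∑ i, MvPolynomial.X i * β (Function.update t j i)).coeff γ = 0 := by
        intro t j γ hγ
        have hnat : ((∑ i, MvPolynomial.X i * β (Function.update t j i)).coeff γ).natDegree ≤ d :=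
          (k1 t j).natDegree_le (by omega)
        refine (av_R1 (k := k' + 1) (M := d) (by omega) hnat ?_).1 (k1 t j γ d (by omega))
        intro m hm
        rw [coeff_sum_X_mul, av_sum]
        refine Finset.sum_eq_zero fun i _ => ?_
        split_ifs with hi
        · have := degree_sub_single hi
          exact avβ _ _ (by omega) m hm
        · exact av_zero' _ _
      -- step 3, 4
      have hβ0 : ∀ (γ : ι →₀ ℕ), γ.degree = e → ∀ t, (β t).coeff γ = 0 := by
        intro γ hγ t
        set A : ℝ[X] := (∑ i, MvPolynomial.X i * α i t).coeff γ with hA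
        have hA' : A = ∑ i, if i ∈ γ.support then (α i t).coeff (γ - Finsupp.single i 1) else 0 := by
          rw [hA, coeff_sum_X_mul]
        -- the differential part
        have hD : (∑ i, if i ∈ γ.support then
            ((MvPolynomial.pderiv i (β t)).coeff (γ - Finsupp.single i 1) -
              ∑ j, (MvPolynomial.pderiv (t j) (β (Function.update t j i))).coeff (γ - Finsupp.single i 1)) else 0)
            = C ((e : ℝ) + k') * (β t).coeff γ := by
          have e1 : (∑ i, if i ∈ γ.support then
            ((MvPolynomial.pderiv i (β t)).coeff (γ - Finsupp.single i 1) -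
              ∑ j, (MvPolynomial.pderiv (t j) (β (Function.update t j i))).coeff (γ - Finsupp.single i 1)) else 0)
              = (∑ i, MvPolynomial.X i * MvPolynomial.pderiv i (β t)).coeff γ -
                ∑ j, (∑ i, MvPolynomial.X i * MvPolynomial.pderiv (t j) (β (Function.update t j i))).coeff γ := by
            simp_rw [coeff_sum_X_mul]
            rw [Finset.sum_comm, ← Finset.sum_sub_distrib]
            refine Finset.sum_congr rfl fun i _ => ?_
            split_ifs with hi
            · rfl
            · simp
          rw [e1, coeff_euler, hγ]
          have e2 : ∀ j, (∑ i, MvPolynomial.X i * MvPolynomial.pderiv (t j) (β (Function.update t j i))).coeff γ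
              = - (β t).coeff γ := by
            intro j
            have e3 : ∑ i, MvPolynomial.X i * MvPolynomial.pderiv (t j) (β (Function.update t j i)) =
                MvPolynomial.pderiv (t j) (∑ i, MvPolynomial.X i * β (Function.update t j i)) - β t := by
              rw [map_sum]
              simp_rw [MvPolynomial.pderiv_mul]
              rw [Finset.sum_add_distrib]
              have e4 : ∑ i, MvPolynomial.pderiv (t j) (MvPolynomial.X i) * β (Function.update t j i) = β t := by
                rw [Finset.sum_eq_single (t j)]
                · simp
                · intro i _ hi
                  rw [MvPolynomial.pderiv_X_of_ne hi]; simp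
                · simp
              rw [e4]; ring
            rw [e3, MvPolynomial.coeff_sub, MvPolynomial.coeff_pderiv, hY t j _ (by
              rw [map_add, Finsupp.degree_single, hγ])]
            simp
          rw [Finset.sum_congr rfl fun j _ => e2 j]
          simp; ring
        refine oneD (k := k' + 1) 0 ((e : ℝ) + k') (by positivity) (J := d) (A := A) ?_
          ((hβ t).natDegree_le (by omega)) (avβ t γ hγ) ?_ ?_ ?_
        · rw [hA']
          refine natDegree_sum_le_of_forall_le _ _ fun i _ => ?_
          split_ifs with hi
          · have := degree_sub_single hi
            exact (hα i t).natDegree_le (by omega)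
          · simp
        · intro m hm
          have hsum : ∀ i, av (k' + 1) (fun z => (if i ∈ γ.support then (α i t).coeff (γ - Finsupp.single i 1) else 0).eval z) (-1 - m)
              + ∫ s in stdSimplexSet (k' + 1), s 0 * (if i ∈ γ.support then
            ((MvPolynomial.pderiv i (β t)).coeff (γ - Finsupp.single i 1) -
              ∑ j, (MvPolynomial.pderiv (t j) (β (Function.update t j i))).coeff (γ - Finsupp.single i 1)) else 0).eval
                ((-1 - m) + ∑ j, s j) = 0 := by
            intro i
            split_ifs with hi
            · have hd := degree_sub_single hi
              refine step3 (e := e) (-1 - m) i t (α i t) (β t) (fun j => β (Function.update t j i)) (by omega)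
                ?_ (hxβ t) (fun j => hxβ _) ?_ ?_ ?_
              · intro δ hδ; exact hxα' δ (by omega) i t
              · intro x hx; exact F1 t m x (by omega)
              · intro j x hx; exact F1 _ m x (by omega)
              · intro x hx; exact F2 i t m x (by omega)
            · simp [av]
          have hs := Finset.sum_eq_zero (s := Finset.univ) fun i _ => hsum i
          rw [Finset.sum_add_distrib, ← av_sum, ← hA',
            ← integral_finsetSum _ (fun i _ => integrableOn_sS (by fun_prop))] at hs
          rw [← hs]
          congr 1
          rw [← integral_const_mul]
          refine integral_congr_ae (Filter.Eventually.of_forall fun s => ?_)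
          simp only
          rw [← Finset.mul_sum, ← eval_finsetSum, hD]
          simp; ring
        · rw [hA', eval_finsetSum]
          refine Finset.sum_eq_zero fun i _ => ?_
          split_ifs with hi
          · exact htr _ _ _
          · simp
        · have := k2 t γ (d + 1) (by omega)
          rw [MvPolynomial.coeff_add, MvPolynomial.coeff_C_mul, coeff_add, coeff_X_mul] at this
          exact this
      intro γ hγ
      refine ⟨hxα' γ hγ, fun t => ?_⟩
      rcases eq_or_lt_of_le hγ with h | h
      · exact hβ0 γ h.symm t
      · exact hxβ t γ h
  have := main (r + 1) 0 (by omega)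
  exact ⟨fun i t => by ext1 γ; exact (this γ (Nat.zero_le _)).1 i t,
    fun t => by ext1 γ; exact (this γ (Nat.zero_le _)).2 t⟩

end Bpart3

section Cpart1
set_option linter.unusedSectionVars false
variable {ι : Type*} [Fintype ι] [DecidableEq ι]

lemma ev_add (L : ℝ) (x : ι → ℝ) (p q : MvPolynomial ι (Polynomial ℝ)) :
    ev L x (p + q) = ev L x p + ev L x q := by simp [ev]
lemma ev_sub (L : ℝ) (x : ι → ℝ) (p q : MvPolynomial ι (Polynomial ℝ)) :
    ev L x (p - q) = ev L x p - ev L x q := by simp [ev]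
lemma ev_mul (L : ℝ) (x : ι → ℝ) (p q : MvPolynomial ι (Polynomial ℝ)) :
    ev L x (p * q) = ev L x p * ev L x q := by simp [ev]
lemma ev_X (L : ℝ) (x : ι → ℝ) (i : ι) :
    ev L x (MvPolynomial.X i) = x i := by simp [ev]
lemma ev_CX (L : ℝ) (x : ι → ℝ) :
    ev L x (MvPolynomial.C Polynomial.X) = L := by simp [ev]
lemma ev_CC (L : ℝ) (x : ι → ℝ) (c : ℝ) :
    ev L x (MvPolynomial.C (Polynomial.C c)) = c := by simp [ev]
lemma ev_sum {κ : Type*} (L : ℝ) (x : ι → ℝ) (S : Finset κ) (p : κ → MvPolynomial ι (Polynomial ℝ)) :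
    ev L x (∑ i ∈ S, p i) = ∑ i ∈ S, ev L x (p i) := by simp [ev]

lemma Deg.add {r : ℕ} {p q : MvPolynomial ι (Polynomial ℝ)} (hp : Deg r p) (hq : Deg r q) :
    Deg r (p + q) := fun γ j h => by
  rw [MvPolynomial.coeff_add, Polynomial.coeff_add, hp γ j h, hq γ j h, add_zero]

lemma Deg.mono {r r' : ℕ} (h : r ≤ r') {p : MvPolynomial ι (Polynomial ℝ)} (hp : Deg r p) : Deg r' p :=
  fun γ j hj => hp γ j (by omega)

lemma Deg.mul {a b : ℕ} {p q : MvPolynomial ι (Polynomial ℝ)} (hp : Deg a p) (hq : Deg b q) :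
    Deg (a + b) (p * q) := fun γ j h => by
  rw [MvPolynomial.coeff_mul, Polynomial.finsetSum_coeff]
  refine Finset.sum_eq_zero fun x hx => ?_
  rw [Polynomial.coeff_mul]
  refine Finset.sum_eq_zero fun y hy => ?_
  have h1 : Finsupp.degree x.1 + Finsupp.degree x.2 = Finsupp.degree γ := by
    rw [← map_add, Finset.HasAntidiagonal.mem_antidiagonal.1 hx]
  have h2 := Finset.HasAntidiagonal.mem_antidiagonal.1 hy
  by_cases hc : a < y.1 + Finsupp.degree x.1
  · rw [hp _ _ hc, zero_mul]
  · rw [hq _ _ (by omega), mul_zero]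

lemma Deg_CC (c : ℝ) : Deg 0 (MvPolynomial.C (Polynomial.C c) : MvPolynomial ι (Polynomial ℝ)) := by
  intro γ j h
  rw [MvPolynomial.coeff_C]
  split_ifs with h0
  · subst h0
    rw [Polynomial.coeff_C, if_neg]; simp at h; omega
  · simp

lemma Deg_CX : Deg 1 (MvPolynomial.C Polynomial.X : MvPolynomial ι (Polynomial ℝ)) := by
  intro γ j h
  rw [MvPolynomial.coeff_C]
  split_ifs with h0
  · subst h0
    rw [Polynomial.coeff_X, if_neg]; simp at h; omega
  · simp

lemma Deg_X (i : ι) : Deg 1 (MvPolynomial.X i : MvPolynomial ι (Polynomial ℝ)) := by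
  intro γ j h
  rw [MvPolynomial.coeff_X]
  split_ifs with h0
  · subst h0
    rw [Polynomial.coeff_one, if_neg]; simp at h; omega
  · simp

/-- the function is given by a polynomial of total degree at most `r` -/
def PR (r : ℕ) (f : ℝ → (ι → ℝ) → ℝ) : Prop := ∃ p, Deg r p ∧ ∀ L x, f L x = ev L x p

lemma PR.add {r : ℕ} {f g : ℝ → (ι → ℝ) → ℝ} (hf : PR r f) (hg : PR r g) :
    PR r (fun L x => f L x + g L x) := by
  obtain ⟨p, hp, hp'⟩ := hf
  obtain ⟨q, hq, hq'⟩ := hg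
  exact ⟨p + q, hp.add hq, fun L x => by simp only [ev_add, hp', hq']⟩

lemma PR.mul {a b : ℕ} {f g : ℝ → (ι → ℝ) → ℝ} (hf : PR a f) (hg : PR b g) :
    PR (a + b) (fun L x => f L x * g L x) := by
  obtain ⟨p, hp, hp'⟩ := hf
  obtain ⟨q, hq, hq'⟩ := hg
  exact ⟨p * q, hp.mul hq, fun L x => by simp only [ev_mul, hp', hq']⟩

lemma PR.mono {r r' : ℕ} (h : r ≤ r') {f : ℝ → (ι → ℝ) → ℝ} (hf : PR r f) : PR r' f := by
  obtain ⟨p, hp, hp'⟩ := hf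
  exact ⟨p, hp.mono h, hp'⟩

lemma PR_const (c : ℝ) : PR (ι := ι) 0 (fun _ _ => c) :=
  ⟨_, Deg_CC c, fun L x => by rw [ev_CC]⟩

lemma PR_L : PR (ι := ι) 1 (fun L _ => L) := ⟨_, Deg_CX, fun L x => by rw [ev_CX]⟩

lemma PR_X (i : ι) : PR (ι := ι) 1 (fun _ x => x i) := ⟨_, Deg_X i, fun L x => by rw [ev_X]⟩

lemma PR.sum {κ : Type*} {r : ℕ} (S : Finset κ) (f : κ → ℝ → (ι → ℝ) → ℝ) (h : ∀ i ∈ S, PR r (f i)) :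
    PR r (fun L x => ∑ i ∈ S, f i L x) := by
  classical
  induction S using Finset.induction_on with
  | empty => simpa using (PR_const 0).mono (Nat.zero_le r)
  | insert a S ha ih =>
    simp_rw [Finset.sum_insert ha]
    exact (h a (Finset.mem_insert_self _ _)).add (ih fun i hi => h i (Finset.mem_insert_of_mem hi))

lemma PR.prod {κ : Type*} (S : Finset κ) (f : κ → ℝ → (ι → ℝ) → ℝ) (d : κ → ℕ)
    (h : ∀ i ∈ S, PR (d i) (f i)) :
    PR (∑ i ∈ S, d i) (fun L x => ∏ i ∈ S, f i L x) := by
  classical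
  induction S using Finset.induction_on with
  | empty => simpa using (PR_const 1)
  | insert a S ha ih =>
    simp_rw [Finset.prod_insert ha, Finset.sum_insert ha]
    exact (h a (Finset.mem_insert_self _ _)).mul (ih fun i hi => h i (Finset.mem_insert_of_mem hi))

lemma PR.pow {r : ℕ} {f : ℝ → (ι → ℝ) → ℝ} (h : PR r f) (e : ℕ) :
    PR (e * r) (fun L x => f L x ^ e) := by
  have := PR.prod (Finset.range e) (fun _ => f) (fun _ => r) (fun _ _ => h)
  simpa using this

lemma PR_pullback {n r : ℕ} (p : MvPolynomial (Fin n) ℝ) (hp : p.totalDegree ≤ r)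
    (c g : Fin n → ℝ) (h : ι → Fin n → ℝ) :
    PR r (fun L x => MvPolynomial.eval (c + L • g + ∑ i, x i • h i) p) := by
  simp_rw [MvPolynomial.eval_eq']
  refine PR.sum _ _ fun β hβ => ?_
  have hc : ∀ l : Fin n, PR (ι := ι) 1 (fun L x => (c + L • g + ∑ i, x i • h i) l) := by
    intro l
    have : ∀ (L : ℝ) (x : ι → ℝ), (c + L • g + ∑ i, x i • h i) l = c l + L * g l + ∑ i, x i * h i l := by
      intro L x; simp [Finset.sum_apply]
    simp_rw [this]
    refine (((PR_const _).mono (Nat.zero_le 1)).add (PR_L.mul (PR_const _))).add (PR.sum _ _ fun i _ => ?_)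
    exact (PR_X i).mul (PR_const _)
  have h2 := (PR_const (ι := ι) (p.coeff β)).mul (PR.prod Finset.univ
    (fun l L x => (c + L • g + ∑ i, x i • h i) l ^ β l) (fun l => β l * 1) (fun l _ => (hc l).pow (β l)))
  refine h2.mono ?_
  have := MvPolynomial.le_totalDegree hβ
  rw [Finsupp.sum_fintype _ _ (by simp)] at this
  simp only [mul_one, zero_add]; omega

end Cpart1

/-! ### structure of the space -/

section Cpart2
variable {n k r : ℕ}

lemma lam_poly (l : (Fin n → ℝ) →ᵃ[ℝ] ℝ) : ∃ p : MvPolynomial (Fin n) ℝ, p.totalDegree ≤ 1 ∧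
    ∀ x, l x = MvPolynomial.eval x p := by
  refine ⟨∑ i, MvPolynomial.C (l.linear (Pi.single i 1)) * MvPolynomial.X i + MvPolynomial.C (l 0), ?_, ?_⟩
  · refine (MvPolynomial.totalDegree_add _ _).trans (max_le ?_ (by simp))
    refine MvPolynomial.totalDegree_finsetSum_le fun i _ => ?_
    refine (MvPolynomial.totalDegree_mul _ _).trans ?_
    simp
  · intro x
    have h1 : l x = l.linear x + l 0 := by
      have := l.map_vadd 0 x
      simpa using this
    have h2 : l.linear x = ∑ i, l.linear (Pi.single i 1) * x i := by
      conv_lhs => rw [pi_eq_sum_univ' x]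
      rw [map_sum]
      refine Finset.sum_congr rfl fun i _ => ?_
      rw [map_smul, smul_eq_mul, mul_comm]
    rw [h1, h2]; simp

lemma whitney_det (lam : Fin (n + 1) → ((Fin n → ℝ) →ᵃ[ℝ] ℝ)) (σ : Fin (k + 1) → Fin (n + 1))
    (x : Fin n → ℝ) (u : Fin k → Fin n → ℝ) :
    whitney lam σ x u = Matrix.det (Matrix.of fun j i : Fin (k + 1) =>
      (Fin.cons (lam (σ i) x) (fun b => (lam (σ i)).linear (u b)) : Fin (k + 1) → ℝ) j) := by
  rw [Matrix.det_succ_row_zero]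
  unfold whitney
  refine Finset.sum_congr rfl fun i _ => ?_
  simp only [Matrix.of_apply, Fin.cons_zero]
  congr 1
  rw [← Matrix.det_transpose]
  congr 1

lemma whitney_lin (lam : Fin (n + 1) → ((Fin n → ℝ) →ᵃ[ℝ] ℝ)) (σ : Fin (k + 1) → Fin (n + 1))
    (U : Fin k → Fin n → ℝ) : ∃ c : Fin (k + 1) → ℝ, ∀ x, whitney lam σ x U = ∑ i, c i * lam (σ i) x := by
  refine ⟨fun i => (-1 : ℝ) ^ (i : ℕ) * 
    Matrix.det (Matrix.of fun a b : Fin k => (lam (σ (i.succAbove a))).linear (U b)), fun x => ?_⟩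
  unfold whitney
  exact Finset.sum_congr rfl fun i _ => by ring

lemma whitney_lin' (lam : Fin (n + 1) → ((Fin n → ℝ) →ᵃ[ℝ] ℝ)) (σ : Fin (k + 1) → Fin (n + 1))
    (U : Fin k → Fin n → ℝ) (j : Fin k) (q : Fin n → ℝ) :
    ∃ c : Fin (k + 1) → ℝ, ∀ x, whitney lam σ x (Function.update U j (x - q)) = ∑ i, c i * lam (σ i) x := by
  let C : Fin (k + 1) → Fin k → ℝ := fun i b => if b = j then - lam (σ i) q else (lam (σ i)).linear (U b)
  refine ⟨fun i => (-1 : ℝ) ^ (i : ℕ) * 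
    Matrix.det (Matrix.of fun b a : Fin k => C (i.succAbove a) b), fun x => ?_⟩
  rw [whitney_det]
  rw [Matrix.det_eq_of_forall_row_eq_smul_add_const (B := Matrix.of fun j i : Fin (k + 1) =>
      (Fin.cons (lam (σ i) x) (C i) : Fin (k + 1) → ℝ) j) (Pi.single j.succ 1) 0 (by
        rw [Pi.single_eq_of_ne (Fin.succ_ne_zero j).symm])]
  · rw [Matrix.det_succ_row_zero]
    refine Finset.sum_congr rfl fun i _ => ?_
    simp only [Matrix.of_apply, Fin.cons_zero]
    rw [mul_right_comm]
    rfl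
  · intro a i
    refine Fin.cases ?_ (fun b => ?_) a
    · simp [Pi.single_eq_of_ne (Fin.succ_ne_zero j).symm]
    · simp only [Matrix.of_apply, Fin.cons_succ, Fin.cons_zero, C]
      by_cases hb : b = j
      · subst hb
        have := (lam (σ i)).linearMap_vsub x q
        simp only [vsub_eq_sub] at this
        simp [this]; ring
      · simp [hb]

/-- polynomiality along a field of tuples -/
lemma PrMinus_poly (hr : 1 ≤ r) (lam : Fin (n + 1) → ((Fin n → ℝ) →ᵃ[ℝ] ℝ))
    (u : (Fin n → ℝ) → Fin k → Fin n → ℝ)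
    (hu : ∀ σ : Fin (k + 1) → Fin (n + 1), ∃ c : Fin (k + 1) → ℝ, ∀ x, whitney lam σ x (u x) = ∑ i, c i * lam (σ i) x)
    {ω : Form n k} (hω : ω ∈ PrMinus n k r lam) :
    ∃ p : MvPolynomial (Fin n) ℝ, p.totalDegree ≤ r ∧ ∀ x, ω x (u x) = MvPolynomial.eval x p := by
  induction hω using Submodule.span_induction with
  | mem η hη =>
    obtain ⟨p, σ, -, hp, rfl⟩ := hη
    obtain ⟨c, hc⟩ := hu σ
    choose q hq hq' using fun i => lam_poly (lam (σ i))
    refine ⟨p * ∑ i, MvPolynomial.C (c i) * q i, ?_, fun x => ?_⟩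
    · refine (MvPolynomial.totalDegree_mul _ _).trans ?_
      have : (∑ i, MvPolynomial.C (c i) * q i).totalDegree ≤ 1 := by
        refine MvPolynomial.totalDegree_finsetSum_le fun i _ => ?_
        refine (MvPolynomial.totalDegree_mul _ _).trans ?_
        have := hq i
        simp; exact this
      omega
    · simp only [hc x, hq']; simp
  | zero => exact ⟨0, by simp, fun x => by simp⟩
  | add a b _ _ ha hb =>
    obtain ⟨p, hp, hp'⟩ := ha
    obtain ⟨q, hq, hq'⟩ := hb
    exact ⟨p + q, (MvPolynomial.totalDegree_add _ _).trans (max_le hp hq), fun x => by simp [hp', hq']⟩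
  | smul c a _ ha =>
    obtain ⟨p, hp, hp'⟩ := ha
    exact ⟨c • p, (MvPolynomial.totalDegree_smul_le _ _).trans hp, fun x => by simp [hp']⟩

lemma alt_sum_apply {κ : Type*} (S : Finset κ) (f : κ → (Fin n → ℝ) [⋀^Fin k]→ₗ[ℝ] ℝ)
    (u : Fin k → Fin n → ℝ) : (∑ i ∈ S, f i) u = ∑ i ∈ S, f i u := by
  classical
  induction S using Finset.induction_on with
  | empty => simp
  | insert a S ha ih => rw [Finset.sum_insert ha, Finset.sum_insert ha, AlternatingMap.add_apply, ih]

lemma PrMinus_alt (lam : Fin (n + 1) → ((Fin n → ℝ) →ᵃ[ℝ] ℝ))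
    {ω : Form n k} (hω : ω ∈ PrMinus n k r lam) (x : Fin n → ℝ) :
    ∃ a : (Fin n → ℝ) [⋀^Fin k]→ₗ[ℝ] ℝ, ∀ u, ω x u = a u := by
  induction hω using Submodule.span_induction with
  | mem η hη =>
    obtain ⟨p, σ, -, hp, rfl⟩ := hη
    refine ⟨∑ i : Fin (k + 1), (MvPolynomial.eval x p * ((-1 : ℝ) ^ (i : ℕ) * lam (σ i) x)) • 
      (Matrix.detRowAlternating (n := Fin k) (R := ℝ)).compLinearMap
        (LinearMap.pi fun a => (lam (σ (i.succAbove a))).linear), fun u => ?_⟩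
    rw [alt_sum_apply]
    simp only [whitney,  AlternatingMap.smul_apply,
      AlternatingMap.compLinearMap_apply, Finset.mul_sum, smul_eq_mul]
    refine Finset.sum_congr rfl fun i _ => ?_
    rw [← mul_assoc]
    congr 1
    rw [← Matrix.det_transpose]
    rfl
  | zero => exact ⟨0, fun x => by simp⟩
  | add a b _ _ ha hb =>
    obtain ⟨p, hp⟩ := ha
    obtain ⟨q, hq⟩ := hb
    exact ⟨p + q, fun x => by simp [hp, hq]⟩
  | smul c a _ ha =>
    obtain ⟨p, hp⟩ := ha
    exact ⟨c • p, fun x => by simp [hp]⟩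

/-- what is used about an element of the space -/
structure Good (r : ℕ) (ω : Form n k) : Prop where
  alt : ∀ x, ∃ a : (Fin n → ℝ) [⋀^Fin k]→ₗ[ℝ] ℝ, ∀ u, ω x u = a u
  poly : ∀ U, ∃ p : MvPolynomial (Fin n) ℝ, p.totalDegree ≤ r ∧ ∀ x, ω x U = MvPolynomial.eval x p
  koszul : ∀ U j q, ∃ p : MvPolynomial (Fin n) ℝ, p.totalDegree ≤ r ∧
    ∀ x, ω x (Function.update U j (x - q)) = MvPolynomial.eval x p

lemma PrMinus_good (hr : 1 ≤ r) (lam : Fin (n + 1) → ((Fin n → ℝ) →ᵃ[ℝ] ℝ))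
    {ω : Form n k} (hω : ω ∈ PrMinus n k r lam) : Good r ω :=
  ⟨PrMinus_alt lam hω, fun U => PrMinus_poly hr lam (fun _ => U) (fun σ => whitney_lin lam σ U) hω,
    fun U j q => PrMinus_poly hr lam (fun x => Function.update U j (x - q))
      (fun σ => whitney_lin' lam σ U j q) hω⟩

lemma Good.continuous {ω : Form n k} (h : Good r ω) (U : Fin k → Fin n → ℝ) : Continuous fun x => ω x U := by
  obtain ⟨p, -, hp⟩ := h.poly U
  simp_rw [hp]
  exact MvPolynomial.continuous_eval p

end Cpart2

section Cpart3
variable {V : Type*} [AddCommGroup V] [Module ℝ V] {k : ℕ}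

/-- adding to some slots a vector present in another slot changes nothing -/
lemma alt_add_slots (a : V [⋀^Fin k]→ₗ[ℝ] ℝ) (u : Fin k → V) (j0 : Fin k) (S : Finset (Fin k)) (hS : j0 ∉ S) :
    a (fun j => if j ∈ S then u j + u j0 else u j) = a u := by
  induction S using Finset.induction_on with
  | empty => simp
  | insert b S hb ih =>
    have hb0 : b ≠ j0 := fun h => hS (h ▸ Finset.mem_insert_self _ _)
    have hS' : j0 ∉ S := fun h => hS (Finset.mem_insert_of_mem h)
    set F : Fin k → V := fun j => if j ∈ S then u j + u j0 else u j with hF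
    have e1 : (fun j => if j ∈ insert b S then u j + u j0 else u j) = Function.update F b (F b + u j0) := by
      ext j
      by_cases hj : j = b
      · subst hj; simp [hF, hb]
      · simp [hF, hj]
    rw [e1, AlternatingMap.map_update_add, Function.update_eq_self, ih hS', add_eq_left]
    refine a.map_eq_zero_of_eq _ (i := b) (j := j0) ?_ hb0
    simp [hb0.symm, hF, hS']

lemma alt_add_const (a : V [⋀^Fin k]→ₗ[ℝ] ℝ) (w : Fin k → V) (g : V) :
    a (fun j => w j + g) = a w + ∑ j, a (Function.update w j g) := by
  suffices h : ∀ S : Finset (Fin k), a (fun j => if j ∈ S then w j + g else w j) =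
      a w + ∑ j ∈ S, a (Function.update w j g) by simpa using h Finset.univ
  intro S
  induction S using Finset.induction_on with
  | empty => simp
  | insert b S hb ih =>
    set F : Fin k → V := fun j => if j ∈ S then w j + g else w j with hF
    have e1 : (fun j => if j ∈ insert b S then w j + g else w j) = Function.update F b (F b + g) := by
      ext j
      by_cases hj : j = b
      · subst hj; simp [hF, hb]
      · simp [hF, hj]
    rw [e1, AlternatingMap.map_update_add, Function.update_eq_self, ih, Finset.sum_insert hb]
    have e2 : a (Function.update F b g) = a (Function.update w b g) := by
      rw [← alt_add_slots a (Function.update w b g) b S hb]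
      congr 1
      ext j
      by_cases hj : j = b
      · subst hj; simp [hb]
      · simp [hF, hj]
    rw [e2]; ring

lemma alt_F1 (a : V [⋀^Fin (k + 1)]→ₗ[ℝ] ℝ) (w : Fin k → V) (g : V) :
    a (Fin.cons g (fun j => w j + g)) = a (Fin.cons g w) := by
  rw [← alt_add_slots a (Fin.cons g w) 0 (Finset.univ.erase 0) (by simp)]
  congr 1
  ext j
  refine Fin.cases ?_ (fun i => ?_) j
  · simp
  · simp

lemma alt_F2 (a : V [⋀^Fin (k + 1)]→ₗ[ℝ] ℝ) (w : Fin k → V) (w0 g : V) :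
    a (Fin.cons (w0 + g) (fun j => w j + g)) = a (Fin.cons w0 w) + a (Fin.cons g w)
      - ∑ j, a (Fin.cons g (Function.update w j w0)) := by
  have e : (Fin.cons (w0 + g) (fun j => w j + g) : Fin (k + 1) → V) =
      fun j => (Fin.cons w0 w : Fin (k + 1) → V) j + g := by
    ext j
    refine Fin.cases ?_ (fun i => ?_) j <;> simp
  rw [e, alt_add_const, Fin.sum_univ_succ, Fin.update_cons_zero, ← add_assoc, sub_eq_add_neg, ← Finset.sum_neg_distrib]
  congr 1
  refine Finset.sum_congr rfl fun j _ => ?_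
  rw [← Fin.cons_update]
  have := a.map_swap (Fin.cons w0 (Function.update w j g)) (i := 0) (j := j.succ) (Fin.succ_ne_zero j).symm
  rw [← neg_eq_iff_eq_neg, ← this]
  congr 1
  ext i
  refine Fin.cases ?_ (fun i => ?_) i
  · simp
  · by_cases hi : i = j
    · subst hi
      simp only [Function.comp, Equiv.swap_apply_right, Fin.cons_succ, Fin.cons_zero, Function.update_self]
    · simp only [Function.comp]
      rw [Equiv.swap_apply_of_ne_of_ne (Fin.succ_ne_zero i) (by simpa using hi)]
      simp [hi]

end Cpart3

section Cpart4
variable {n k r : ℕ}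

/-- any injective tuple can be sorted -/
lemma int_sorted {ω : Form n k} (hω : Good r ω) (Q : Fin n → ℝ) (c : ℝ) (w : Fin (n + 1) → Fin n → ℝ)
    (P : Fin (n + 1) → Prop)
    (H : ∀ T : Fin k → Fin (n + 1), StrictMono T → (∀ j, P (T j)) →
      ∫ s in stdSimplexSet k, ω (Q + c • ∑ j, s j • w (T j)) (fun j => w (T j)) = 0)
    (T : Fin k → Fin (n + 1)) (hT : ∀ j, P (T j)) :
    ∫ s in stdSimplexSet k, ω (Q + c • ∑ j, s j • w (T j)) (fun j => w (T j)) = 0 := by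
  by_cases hinj : Function.Injective T
  · set σ := Tuple.sort T with hσ
    have hm : StrictMono (T ∘ σ) := (Tuple.monotone_sort T).strictMono_of_injective (hinj.comp σ.injective)
    have h := H (T ∘ σ) hm (fun j => hT _)
    rw [← integral_perm_sS σ] at h
    have e : ∀ s : Fin k → ℝ, ω (Q + c • ∑ j, s (σ j) • w ((T ∘ σ) j)) (fun j => w ((T ∘ σ) j)) =
        ((Equiv.Perm.sign σ : ℤ) : ℝ) * ω (Q + c • ∑ j, s j • w (T j)) (fun j => w (T j)) := by
      intro s
      have e1 : ∑ j, s (σ j) • w ((T ∘ σ) j) = ∑ j, s j • w (T j) :=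
        Equiv.sum_comp σ (fun j => s j • w (T j))
      rw [e1]
      obtain ⟨a, ha⟩ := hω.alt (Q + c • ∑ j, s j • w (T j))
      rw [ha, ha]
      have := a.map_perm (fun j => w (T j)) σ
      rw [show (fun j => w ((T ∘ σ) j)) = (fun j => w (T j)) ∘ σ from rfl, this]
      rcases Int.units_eq_one_or (Equiv.Perm.sign σ) with h | h <;> simp [h]
    simp_rw [e] at h
    rw [integral_const_mul] at h
    rcases mul_eq_zero.1 h with h | h
    · exfalso
      rcases Int.units_eq_one_or (Equiv.Perm.sign σ) with h' | h' <;> simp [h'] at h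
    · exact h
  · have : ∃ i j, T i = T j ∧ i ≠ j := by
      simpa [Function.Injective] using hinj
    obtain ⟨i, j, hij, hne⟩ := this
    have : ∀ s : Fin k → ℝ, ω (Q + c • ∑ j, s j • w (T j)) (fun j => w (T j)) = 0 := by
      intro s
      obtain ⟨a, ha⟩ := hω.alt (Q + c • ∑ j, s j • w (T j))
      rw [ha]
      exact a.map_eq_zero_of_eq _ (by simp [hij]) hne
    simp_rw [this]; simp

/-- splitting of a sum over the vertices of a face -/
lemma face_split {E : Type*} [AddCommMonoid E] (m : Fin (n + 1)) (hm : m < Fin.last n) (f : Fin (n + 1) → E)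
    (hf : ∀ i < m, f i = 0) :
    ∑ i, f i = f m + ∑ i : {a : Fin (n + 1) // m < a ∧ a < Fin.last n}, f i + f (Fin.last n) := by
  classical
  have h1 : ∑ i : {a : Fin (n + 1) // m < a ∧ a < Fin.last n}, f i =
      ∑ i ∈ Finset.univ.filter (fun a => m < a ∧ a < Fin.last n), f i := by
    exact (Finset.sum_subtype _ (by simp) f).symm
  have h2 : ∑ i, f i = ∑ i ∈ insert (Fin.last n) (insert m (Finset.univ.filter (fun a => m < a ∧ a < Fin.last n))), f i := by
    symm
    apply Finset.sum_subset (Finset.subset_univ _)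
    intro i _ hi
    apply hf
    simp only [Finset.mem_insert, Finset.mem_filter, Finset.mem_univ, true_and, not_or, not_and] at hi
    by_contra hc
    have h3 : m < i := lt_of_le_of_ne (not_lt.1 hc) (Ne.symm hi.2.1)
    exact hi.2.2 h3 (lt_of_le_of_ne (Fin.le_last i) hi.1)
  rw [h2, Finset.sum_insert, Finset.sum_insert, h1]
  · rw [add_comm]
  · simp
  · simp [hm.ne']

end Cpart4

section Cpart5
variable {n k r : ℕ}

/-- vertices strictly between `m` and the last one -/
abbrev Mid (n : ℕ) (m : Fin (n + 1)) : Type := {a : Fin (n + 1) // m < a ∧ a < Fin.last n}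

/-- multi-index with prescribed entries -/
def mkIdx (r : ℕ) (m : Fin (n + 1)) (c : ℕ) (x : Mid n m → ℕ) : Fin (n + 1) → ℕ := fun i =>
  if h : m < i ∧ i < Fin.last n then x ⟨i, h⟩ else if i = m then c
    else if i = Fin.last n then r - 1 - c - ∑ a, x a else 0

lemma mkIdx_m (m : Fin (n + 1)) (c : ℕ) (x : Mid n m → ℕ) : mkIdx r m c x m = c := by
  simp [mkIdx]

lemma mkIdx_mid (m : Fin (n + 1)) (c : ℕ) (x : Mid n m → ℕ) (a : Mid n m) : mkIdx r m c x a = x a := by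
  simp [mkIdx, a.2]

lemma mkIdx_last (m : Fin (n + 1)) (hm : m < Fin.last n) (c : ℕ) (x : Mid n m → ℕ) :
    mkIdx r m c x (Fin.last n) = r - 1 - c - ∑ a, x a := by
  simp [mkIdx, hm.ne']

lemma mkIdx_lt (m : Fin (n + 1)) (c : ℕ) (x : Mid n m → ℕ) (i : Fin (n + 1)) (hi : i < m) :
    mkIdx r m c x i = 0 := by
  have h1 : ¬ (m < i) := not_lt.2 hi.le
  have h2 : i ≠ Fin.last n := (hi.trans_le (Fin.le_last m)).ne
  simp [mkIdx, h1, h2, hi.ne]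

/-- the point with parameters `L, x` on the face -/
def Pt (v : Fin (n + 1) → Fin n → ℝ) (r : ℕ) (m : Fin (n + 1)) (L : ℝ) (x : Mid n m → ℝ) : Fin n → ℝ :=
  v (Fin.last n) + (r : ℝ)⁻¹ • (L • (v (Fin.last n) - v m) + ∑ a, x a • (v a - v (Fin.last n)))

lemma weight_zero (hr : 1 ≤ r) {v : Fin (n + 1) → Fin n → ℝ} {ω : Form n k} (hω : Good r ω)
    (W : ∀ q : MinIdx n k r, simpIntegral ω (smallSimplex v r q.val.1 q.val.2) = 0)
    (m : Fin (n + 1)) (hm : m < Fin.last n) (c : ℕ) (x : Mid n m → ℕ) (hcx : c + 1 + ∑ a, x a ≤ r)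
    (T : Fin k → Fin (n + 1)) (hT : ∀ j, m < T j) :
    ∫ s in stdSimplexSet k, ω (Pt v r m (-1 - c) (fun a => x a) + (r : ℝ)⁻¹ • ∑ j, s j • (v (T j) - v m))
      (fun j => v (T j) - v m) = 0 := by
  have hr0 : (r : ℝ) ≠ 0 := by positivity
  refine int_sorted hω _ _ (fun i => v i - v m) (fun i => m < i) (fun T hmono hT => ?_) T hT
  have hσ : StrictMono (Fin.cons m T : Fin (k + 1) → Fin (n + 1)) := by
    rw [Fin.strictMono_iff_lt_succ]
    intro i
    cases k with
    | zero => exact i.elim0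
    | succ k =>
      refine Fin.cases ?_ (fun i => ?_) i
      · simp [hT]
      · rw [← Fin.succ_castSucc, Fin.cons_succ, Fin.cons_succ]; exact hmono (Fin.castSucc_lt_succ)
  have hsum : ∑ i, mkIdx r m c x i = r - 1 := by
    rw [face_split m hm _ (fun i hi => mkIdx_lt m c x i hi), mkIdx_m, mkIdx_last m hm]
    simp_rw [mkIdx_mid]
    change c + ∑ a, x a + _ = _
    omega
  have h := W ⟨(Fin.cons m T, mkIdx r m c x), hσ, hsum, fun i hi => mkIdx_lt m c x i hi⟩
  have hp : smallSimplex v r (Fin.cons m T : Fin (k + 1) → Fin (n + 1)) (mkIdx r m c x) 0 = Pt v r m (-1 - c) (fun a => x a) := by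
    unfold smallSimplex Pt
    rw [face_split m hm (fun i => (mkIdx r m c x i : ℝ) • v i) (fun i hi => by simp [mkIdx_lt m c x i hi]), mkIdx_m, mkIdx_last m hm]
    simp_rw [mkIdx_mid]
    have e1 : ((r - 1 - c - ∑ a, x a : ℕ) : ℝ) = (r : ℝ) - 1 - c - ∑ a, (x a : ℝ) := by
      rw [Nat.cast_sub (by omega), Nat.cast_sub (by omega), Nat.cast_sub (by omega)]; simp
    have e2 : ∑ a, (x a : ℝ) • (v a - v (Fin.last n)) = ∑ a : Mid n m, (x a : ℝ) • v a - (∑ a, (x a : ℝ)) • v (Fin.last n) := by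
      simp_rw [smul_sub, Finset.sum_sub_distrib, Finset.sum_smul]
    rw [e1, e2]
    rw [inv_smul_eq_iff₀ hr0, smul_add, smul_inv_smul₀ hr0]
    simp only [Fin.cons_zero]
    module
  have hd : ∀ j : Fin k, smallSimplex v r (Fin.cons m T : Fin (k + 1) → Fin (n + 1)) (mkIdx r m c x) j.succ -
      smallSimplex v r (Fin.cons m T : Fin (k + 1) → Fin (n + 1)) (mkIdx r m c x) 0 = (r : ℝ)⁻¹ • (v (T j) - v m) := by
    intro j
    unfold smallSimplex
    simp only [Fin.cons_zero, Fin.cons_succ]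
    module
  unfold simpIntegral at h
  simp only [hd] at h
  simp only [hp] at h
  have e : ∀ s : Fin k → ℝ, ω (Pt v r m (-1 - c) (fun a => x a) + ∑ j, s j • (r : ℝ)⁻¹ • (v (T j) - v m)) (fun j => (r : ℝ)⁻¹ • (v (T j) - v m)) =
      ((r : ℝ)⁻¹) ^ k * ω (Pt v r m (-1 - c) (fun a => x a) + (r : ℝ)⁻¹ • ∑ j, s j • (v (T j) - v m)) (fun j => v (T j) - v m) := by
    intro s
    have e1 : ∑ j, s j • (r : ℝ)⁻¹ • (v (T j) - v m) = (r : ℝ)⁻¹ • ∑ j, s j • (v (T j) - v m) := by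
      rw [Finset.smul_sum]; exact Finset.sum_congr rfl fun j _ => smul_comm _ _ _
    rw [e1]
    obtain ⟨a, ha⟩ := hω.alt (Pt v r m (-1 - c) (fun a => x a) + (r : ℝ)⁻¹ • ∑ j, s j • (v (T j) - v m))
    rw [ha, ha]
    have := a.toMultilinearMap.map_smul_univ (fun _ => (r : ℝ)⁻¹) (fun j => v (T j) - v m)
    simpa using this
  simp_rw [e] at h
  rw [integral_const_mul] at h
  exact (mul_eq_zero.1 h).resolve_left (by positivity)

end Cpart5

section Cpart6
variable {n k r : ℕ}

lemma sum_sh {ι E : Type*} [Fintype ι] [DecidableEq ι] [AddCommGroup E] [Module ℝ E] (t : Fin k → ι)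
    (s : Fin (k + 1) → ℝ) (f : ι → E) : ∑ b, sh t s b • f b = ∑ j, s j.succ • f (t j) := by
  unfold sh
  simp_rw [Finset.sum_smul]
  rw [Finset.sum_comm]
  refine Finset.sum_congr rfl fun j _ => ?_
  rw [Finset.sum_eq_single (t j)]
  · simp
  · intro b _ hb; simp [hb.symm]
  · simp

lemma sum_sh1 {ι E : Type*} [Fintype ι] [DecidableEq ι] [AddCommGroup E] [Module ℝ E] (i : ι) (t : Fin k → ι)
    (s : Fin (k + 1) → ℝ) (f : ι → E) :
    ∑ b, sh1 i t s b • f b = s 0 • f i + ∑ j, s j.succ • f (t j) := by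
  unfold sh1
  simp_rw [add_smul, Finset.sum_add_distrib, sum_sh]
  congr 1
  rw [Finset.sum_eq_single i]
  · simp
  · intro b _ hb; simp [hb.symm]
  · simp

lemma Pt_F1 (v : Fin (n + 1) → Fin n → ℝ) (m : Fin (n + 1)) (L : ℝ) (x : Mid n m → ℝ) (t : Fin k → Mid n m)
    (s : Fin (k + 1) → ℝ) :
    Pt v r m (L + ∑ j, s j) (fun b => x b + sh t s b) = Pt v r m L x + (r : ℝ)⁻¹ • ∑ j, s j •
      (v ((Fin.cons (Fin.last n) (fun j => (t j : Fin (n + 1))) : Fin (k + 1) → Fin (n + 1)) j) - v m) := by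
  unfold Pt
  have e1 : ∑ b, (x b + sh t s b) • (v b - v (Fin.last n)) = ∑ b, x b • (v b - v (Fin.last n)) +
      ∑ j, s j.succ • (v (t j) - v (Fin.last n)) := by
    rw [← sum_sh t s (fun b : Mid n m => v b - v (Fin.last n)), ← Finset.sum_add_distrib]
    exact Finset.sum_congr rfl fun b _ => add_smul _ _ _
  have e2 : ∀ j, s (Fin.succ j) • (v (t j) - v m) = s (Fin.succ j) • (v (t j) - v (Fin.last n)) +
      s (Fin.succ j) • (v (Fin.last n) - v m) := fun j => by module
  rw [e1, Fin.sum_univ_succ, Fin.sum_univ_succ]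
  simp only [Fin.cons_zero, Fin.cons_succ, e2, Finset.sum_add_distrib, ← Finset.sum_smul]
  module

lemma Pt_F2 (v : Fin (n + 1) → Fin n → ℝ) (m : Fin (n + 1)) (L : ℝ) (x : Mid n m → ℝ) (i : Mid n m)
    (t : Fin k → Mid n m) (s : Fin (k + 1) → ℝ) :
    Pt v r m (L + ∑ j, s j) (fun b => x b + sh1 i t s b) = Pt v r m L x + (r : ℝ)⁻¹ • ∑ j, s j •
      (v ((Fin.cons (i : Fin (n + 1)) (fun j => (t j : Fin (n + 1))) : Fin (k + 1) → Fin (n + 1)) j) - v m) := by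
  unfold Pt
  have e1 : ∑ b, (x b + sh1 i t s b) • (v b - v (Fin.last n)) = ∑ b, x b • (v b - v (Fin.last n)) +
      (s 0 • (v i - v (Fin.last n)) + ∑ j, s j.succ • (v (t j) - v (Fin.last n))) := by
    rw [← sum_sh1 i t s (fun b : Mid n m => v b - v (Fin.last n)), ← Finset.sum_add_distrib]
    exact Finset.sum_congr rfl fun b _ => add_smul _ _ _
  have e2 : ∀ j, s (Fin.succ j) • (v (t j) - v m) = s (Fin.succ j) • (v (t j) - v (Fin.last n)) +
      s (Fin.succ j) • (v (Fin.last n) - v m) := fun j => by module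
  rw [e1, Fin.sum_univ_succ, Fin.sum_univ_succ]
  simp only [Fin.cons_zero, Fin.cons_succ, e2, Finset.sum_add_distrib, ← Finset.sum_smul]
  module

lemma PR_omega {ω : Form n k} (hω : Good r ω) (v : Fin (n + 1) → Fin n → ℝ) (m : Fin (n + 1))
    (U : Fin k → Fin n → ℝ) : PR r (fun L x => ω (Pt v r m L x) U) := by
  obtain ⟨p, hp, hp'⟩ := hω.poly U
  have := PR_pullback (ι := Mid n m) p hp (v (Fin.last n)) ((r : ℝ)⁻¹ • (v (Fin.last n) - v m))
    (fun a => (r : ℝ)⁻¹ • (v a - v (Fin.last n)))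
  convert this using 3 with L x
  rw [hp']
  congr 2
  unfold Pt
  rw [smul_add, Finset.smul_sum, add_assoc]
  congr 2
  · exact smul_comm _ _ _
  · exact Finset.sum_congr rfl fun a _ => smul_comm _ _ _

lemma PR_koszul (hr : 1 ≤ r) {ω : Form n k} (hω : Good r ω) (v : Fin (n + 1) → Fin n → ℝ) (m : Fin (n + 1))
    (U : Fin k → Fin n → ℝ) (j : Fin k) : PR r (fun L x => ω (Pt v r m L x)
      (Function.update U j (L • (v (Fin.last n) - v m) + ∑ a, x a • (v a - v (Fin.last n))))) := by
  have hr0 : (r : ℝ) ≠ 0 := by positivity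
  obtain ⟨p, hp, hp'⟩ := hω.koszul U j (v (Fin.last n))
  have := (PR_const (ι := Mid n m) (r : ℝ)).mul (PR_pullback (ι := Mid n m) p hp (v (Fin.last n)) ((r : ℝ)⁻¹ • (v (Fin.last n) - v m))
    (fun a => (r : ℝ)⁻¹ • (v a - v (Fin.last n))))
  rw [zero_add] at this
  convert this using 3 with L x
  have e : v (Fin.last n) + L • (r : ℝ)⁻¹ • (v (Fin.last n) - v m) + ∑ a : Mid n m, x a • (r : ℝ)⁻¹ • (v a - v (Fin.last n))
      = Pt v r m L x := by
    unfold Pt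
    rw [smul_add, Finset.smul_sum, add_assoc]
    congr 2
    · exact smul_comm _ _ _
    · exact Finset.sum_congr rfl fun a _ => smul_comm _ _ _
  rw [e, ← hp']
  have e2 : L • (v (Fin.last n) - v m) + ∑ a, x a • (v a - v (Fin.last n)) = (r : ℝ) • (Pt v r m L x - v (Fin.last n)) := by
    unfold Pt
    rw [add_sub_cancel_left, smul_inv_smul₀ hr0]
  rw [e2]
  obtain ⟨a, ha⟩ := hω.alt (Pt v r m L x)
  rw [ha, ha, AlternatingMap.map_update_smul, smul_eq_mul]

lemma cons_comp_update {E ι : Type*} (g : E) (f : ι → E) (t : Fin k → ι) (j : Fin k) (i : ι) :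
    (Fin.cons g (fun l => f (Function.update t j i l)) : Fin (k + 1) → E) =
      Function.update (Fin.cons g (fun l => f (t l))) j.succ (f i) := by
  rw [← Fin.cons_update]
  congr 1
  ext l
  by_cases h : l = j
  · subst h; simp
  · simp [h]

lemma face_core (hr : 1 ≤ r) {v : Fin (n + 1) → Fin n → ℝ} {ω : Form n (k + 1)} (hω : Good r ω)
    (W : ∀ q : MinIdx n (k + 1) r, simpIntegral ω (smallSimplex v r q.val.1 q.val.2) = 0)
    (m : Fin (n + 1)) (hm : m < Fin.last n)
    (hZ : ∀ (x : Mid n m → ℝ) (t : Fin (k + 1) → Mid n m),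
      ω (Pt v r m 0 x) (fun j => v (t j) - v (Fin.last n)) = 0) :
    (∀ (i : Mid n m) (t : Fin k → Mid n m) (L : ℝ) (x : Mid n m → ℝ),
      ω (Pt v r m L x) (Fin.cons (v i - v (Fin.last n)) (fun j => v (t j) - v (Fin.last n))) = 0) ∧
    (∀ (t : Fin k → Mid n m) (L : ℝ) (x : Mid n m → ℝ),
      ω (Pt v r m L x) (Fin.cons (v (Fin.last n) - v m) (fun j => v (t j) - v (Fin.last n))) = 0) := by
  set g := v (Fin.last n) - v m with hg
  set f : Mid n m → Fin n → ℝ := fun i => v i - v (Fin.last n) with hf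
  choose α hαd hα using fun (i : Mid n m) (t : Fin k → Mid n m) =>
    PR_omega hω v m (Fin.cons (f i) (fun j => f (t j)))
  choose β hβd hβ using fun (t : Fin k → Mid n m) =>
    PR_omega hω v m (Fin.cons g (fun j => f (t j)))
  have key := core α β hαd hβd ?_ ?_ ?_ ?_ ?_
  · refine ⟨fun i t L x => ?_, fun t L x => ?_⟩
    · have := hα i t L x
      rw [key.1] at this
      exact this.trans (by simp [ev])
    · have := hβ t L x
      rw [key.2] at this
      exact this.trans (by simp [ev])
  · intro t j
    obtain ⟨p, hp, hp'⟩ := PR_koszul hr hω v m (Fin.cons g (fun j => f (t j))) j.succ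
    convert hp using 1
    rw [← sub_eq_zero]
    refine ev_injective fun L x => ?_
    rw [ev_sub, sub_eq_zero, ← hp', ev_sum]
    simp only [ev_mul, ev_X, ← hβ]
    obtain ⟨a, ha⟩ := hω.alt (Pt v r m L x)
    simp only [ha]
    rw [AlternatingMap.map_update_add, AlternatingMap.map_update_smul, AlternatingMap.map_update_sum]
    rw [a.map_eq_zero_of_eq (i := 0) (j := j.succ) _ _ (Fin.succ_ne_zero j).symm]
    · simp only [smul_zero, zero_add]
      refine Finset.sum_congr rfl fun i _ => ?_
      rw [AlternatingMap.map_update_smul, cons_comp_update, smul_eq_mul]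
    · rw [Function.update_self, Function.update_of_ne (Fin.succ_ne_zero j).symm, Fin.cons_zero]
  · intro t
    obtain ⟨p, hp, hp'⟩ := PR_koszul hr hω v m (Fin.cons 0 (fun j => f (t j))) 0
    convert hp using 1
    rw [← sub_eq_zero]
    refine ev_injective fun L x => ?_
    rw [ev_sub, sub_eq_zero, ← hp', ev_add, ev_sum]
    simp only [ev_mul, ev_X, ev_CX, ← hβ, ← hα]
    obtain ⟨a, ha⟩ := hω.alt (Pt v r m L x)
    simp only [ha]
    rw [AlternatingMap.map_update_add, AlternatingMap.map_update_smul, AlternatingMap.map_update_sum, add_comm]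
    have h4 : ∀ i : Mid n m, a (Function.update (Fin.cons 0 (fun j => f (t j))) 0 (x i • (v i - v (Fin.last n)))) =
        x i * a (Fin.cons (f i) (fun j => f (t j))) := by
      intro i
      rw [AlternatingMap.map_update_smul, Fin.update_cons_zero, smul_eq_mul]
    simp only [h4]
    rw [Fin.update_cons_zero, smul_eq_mul]
  · intro i t γ
    have h1 : MvPolynomial.map (Polynomial.evalRingHom (0 : ℝ)) (α i t) = 0 := by
      refine MvPolynomial.funext fun x => ?_
      have := hα i t 0 x
      rw [map_zero]
      refine this.symm.trans ?_
      have h2 := hZ x (Fin.cons i t)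
      refine Eq.trans ?_ h2
      change ω _ _ = ω _ _
      refine congrArg _ (funext fun j => ?_)
      refine Fin.cases ?_ (fun j => ?_) j <;> simp [hf]
    have h2 := congrArg (MvPolynomial.coeff γ) h1
    rw [MvPolynomial.coeff_map] at h2
    simpa using h2
  · intro t c x hcx
    rw [← weight_zero hr hω W m hm c x hcx (Fin.cons (Fin.last n) (fun j => (t j : Fin (n + 1))))]
    · refine integral_congr_ae (Filter.Eventually.of_forall fun s => ?_)
      simp only
      rw [← hβ]
      simp only
      rw [Pt_F1]
      obtain ⟨a, ha⟩ := hω.alt (Pt v r m (-1 - c) (fun a => x a) + (r : ℝ)⁻¹ • ∑ j, s j •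
        (v ((Fin.cons (Fin.last n) (fun j => (t j : Fin (n + 1))) : Fin (k + 1) → Fin (n + 1)) j) - v m))
      rw [ha, ha, ← alt_F1]
      congr 1
      ext1 j
      refine Fin.cases ?_ (fun j => ?_) j <;> simp [hf, hg]
    · intro j
      refine Fin.cases ?_ (fun j => ?_) j
      · simpa using hm
      · simpa using (t j).2.1
  · intro i t c x hcx
    rw [← weight_zero hr hω W m hm c x hcx (Fin.cons (i : Fin (n + 1)) (fun j => (t j : Fin (n + 1))))]
    · refine integral_congr_ae (Filter.Eventually.of_forall fun s => ?_)
      simp only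
      rw [ev_sub, ev_add, ev_sum]
      simp only [← hβ, ← hα]
      rw [Pt_F2]
      obtain ⟨a, ha⟩ := hω.alt (Pt v r m (-1 - c) (fun a => x a) + (r : ℝ)⁻¹ • ∑ j, s j •
        (v ((Fin.cons (i : Fin (n + 1)) (fun j => (t j : Fin (n + 1))) : Fin (k + 1) → Fin (n + 1)) j) - v m))
      simp only [ha]
      have h3 : (fun j => v ((Fin.cons (i : Fin (n + 1)) (fun j => (t j : Fin (n + 1))) : Fin (k + 1) → Fin (n + 1)) j) - v m) =
          Fin.cons (f i + g) (fun j => f (t j) + g) := by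
        ext1 j
        refine Fin.cases ?_ (fun j => ?_) j <;> simp [hf, hg]
      rw [h3, alt_F2]
      congr 1
      refine Finset.sum_congr rfl fun j _ => ?_
      rw [cons_comp_update, Fin.cons_update]
    · intro j
      refine Fin.cases ?_ (fun j => ?_) j
      · simpa using i.2.1
      · simpa using (t j).2.1

end Cpart6

section Cpart7
variable {n k r : ℕ}

/-- vanishing on the face spanned by the vertices from `m` on -/
def Zf (v : Fin (n + 1) → Fin n → ℝ) (ω : Form n k) (m : ℕ) : Prop :=
  ∀ y : Fin (n + 1) → ℝ, (∀ i : Fin (n + 1), (i : ℕ) < m → y i = 0) → ∀ t : Fin k → Fin (n + 1), (∀ j, m ≤ (t j : ℕ)) →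
    ω (v (Fin.last n) + ∑ i, y i • (v i - v (Fin.last n))) (fun j => v (t j) - v (Fin.last n)) = 0

lemma face_point (hr : 1 ≤ r) (v : Fin (n + 1) → Fin n → ℝ) (m : Fin (n + 1)) (hm : m < Fin.last n)
    (y : Fin (n + 1) → ℝ) (hy : ∀ i, i < m → y i = 0) :
    v (Fin.last n) + ∑ i, y i • (v i - v (Fin.last n)) = Pt v r m (-(r * y m)) (fun a => r * y a) := by
  have hr0 : (r : ℝ) ≠ 0 := by positivity
  rw [face_split m hm _ (fun i hi => by rw [hy i hi, zero_smul])]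
  unfold Pt
  congr 1
  rw [eq_inv_smul_iff₀ hr0, sub_self, smul_zero, add_zero, smul_add, Finset.smul_sum]
  congr 1
  · module
  · exact Finset.sum_congr rfl fun a _ => by rw [smul_smul]

lemma face_step (hr : 1 ≤ r) {v : Fin (n + 1) → Fin n → ℝ} {ω : Form n (k + 1)} (hω : Good r ω)
    (W : ∀ q : MinIdx n (k + 1) r, simpIntegral ω (smallSimplex v r q.val.1 q.val.2) = 0)
    (m : Fin (n + 1)) (hm : m < Fin.last n) (hZ : Zf v ω (m + 1)) : Zf v ω m := by
  have hr0 : (r : ℝ) ≠ 0 := by positivity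
  obtain ⟨hA, hB⟩ := face_core hr hω W m hm (by
    intro x t
    have h := hZ (fun i => if h : m < i ∧ i < Fin.last n then (r : ℝ)⁻¹ * x ⟨i, h⟩ else 0) (by
      intro i hi
      have h1 : ¬ m < i := by rw [Fin.lt_def]; omega
      simp [h1]) (fun j => t j) (by
      intro j
      have := (t j).2.1
      rw [Fin.lt_def] at this; omega)
    rw [face_point hr v m hm] at h
    · convert h using 2
      congr 1
      · simp
      · ext a
        simp [a.2, hr0]
    · intro i hi
      have h1 : ¬ m < i := not_lt.2 hi.le
      simp [h1])
  intro y hy t ht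
  rw [face_point hr v m hm y (fun i hi => hy i (by rwa [Fin.lt_def] at hi))]
  obtain ⟨a, ha⟩ := hω.alt (Pt v r m (-(r * y m)) (fun a => r * y a))
  have hB' : ∀ t : Fin k → Mid n m, a (Fin.cons (v m - v (Fin.last n)) (fun j => v (t j) - v (Fin.last n))) = 0 := by
    intro t
    have h1 := hB t (-(r * y m)) (fun a => r * y a)
    rw [ha] at h1
    have h2 : (Fin.cons (v m - v (Fin.last n)) (fun j => v (t j) - v (Fin.last n)) : Fin (k + 1) → Fin n → ℝ) =
        Function.update (Fin.cons (v (Fin.last n) - v m) (fun j => v (t j) - v (Fin.last n))) 0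
          ((-1 : ℝ) • (v (Fin.last n) - v m)) := by
      rw [Fin.update_cons_zero]; simp
    rw [h2, AlternatingMap.map_update_smul, Fin.update_cons_zero, h1, smul_zero]
  have hA' : ∀ i (t : Fin k → Mid n m), a (Fin.cons (v (i : Mid n m) - v (Fin.last n)) (fun j => v (t j) - v (Fin.last n))) = 0 := by
    intro i t
    have h1 := hA i t (-(r * y m)) (fun a => r * y a)
    rwa [ha] at h1
  rw [ha]
  by_cases hinj : Function.Injective t
  swap
  · have : ∃ i j, t i = t j ∧ i ≠ j := by
      simpa [Function.Injective] using hinj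
    obtain ⟨i, j, hij, hne⟩ := this
    exact a.map_eq_zero_of_eq _ (by simp [hij]) hne
  by_cases hlast : ∃ j, t j = Fin.last n
  · obtain ⟨j, hj⟩ := hlast
    exact a.map_coord_zero j (by simp [hj])
  push Not at hlast
  have hA'' : ∀ t : Fin (k + 1) → Fin (n + 1), (∀ j, m < t (Fin.succ j)) → (∀ j, t j < Fin.last n) → m ≤ t 0 →
      a (fun j => v (t j) - v (Fin.last n)) = 0 := by
    intro t h1 h2 h3
    rcases h3.eq_or_lt with h3 | h3
    · rw [← hB' (fun j => ⟨t j.succ, h1 j, h2 _⟩)]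
      congr 1
      ext1 j
      refine Fin.cases ?_ (fun j => ?_) j <;> simp [h3]
    · rw [← hA' ⟨t 0, h3, h2 _⟩ (fun j => ⟨t j.succ, h1 j, h2 _⟩)]
      congr 1
      ext1 j
      refine Fin.cases ?_ (fun j => ?_) j <;> simp
  have ht' : ∀ j, m ≤ t j := fun j => by rw [Fin.le_def]; exact ht j
  have htl : ∀ j, t j < Fin.last n := fun j => lt_of_le_of_ne (Fin.le_last _) (hlast j)
  by_cases hmm : ∃ j, t j = m
  · obtain ⟨j0, hj0⟩ := hmm
    have h5 := hA'' (t ∘ Equiv.swap 0 j0) (fun j => by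
      refine lt_of_le_of_ne (ht' _) fun h => ?_
      simp only [Function.comp] at h
      rw [← hj0] at h
      have h6 := hinj h
      have h7 : Equiv.swap 0 j0 (Equiv.swap 0 j0 j.succ) = Equiv.swap 0 j0 j0 := by rw [← h6]
      rw [Equiv.swap_apply_self, Equiv.swap_apply_right] at h7
      exact Fin.succ_ne_zero j h7) (fun j => htl _) (ht' _)
    have h6 := a.map_perm (fun j => v (t j) - v (Fin.last n)) (Equiv.swap 0 j0)
    have h7 : a ((fun j => v (t j) - v (Fin.last n)) ∘ Equiv.swap 0 j0) = 0 := h5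
    rw [h7] at h6
    rcases Int.units_eq_one_or (Equiv.Perm.sign (Equiv.swap 0 j0)) with h | h <;> simpa [h] using h6.symm
  · push Not at hmm
    exact hA'' t (fun j => lt_of_le_of_ne (ht' _) (hmm _).symm) htl (ht' _)

lemma face_all (hr : 1 ≤ r) {v : Fin (n + 1) → Fin n → ℝ} {ω : Form n (k + 1)} (hω : Good r ω)
    (W : ∀ q : MinIdx n (k + 1) r, simpIntegral ω (smallSimplex v r q.val.1 q.val.2) = 0) : Zf v ω 0 := by
  suffices h : ∀ d m : ℕ, m + d = n → Zf v ω m from h n 0 (by simp)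
  intro d
  induction d with
  | zero =>
    intro m hm y hy t ht
    obtain ⟨a, ha⟩ := hω.alt (v (Fin.last n) + ∑ i, y i • (v i - v (Fin.last n)))
    rw [ha]
    refine a.map_coord_zero 0 ?_
    have : t 0 = Fin.last n := by
      apply Fin.ext
      have h1 := ht 0
      have h2 := (t 0).2
      simp; omega
    simp [this]
  | succ d ih =>
    intro m hm
    exact face_step hr hω W ⟨m, by omega⟩ (by rw [Fin.lt_def]; simp; omega) (ih (m + 1) (by omega))

/-! ### barycentric coordinates -/

variable {v : Fin (n + 1) → Fin n → ℝ} {lam : Fin (n + 1) → ((Fin n → ℝ) →ᵃ[ℝ] ℝ)}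

lemma bary_point (hv : AffineIndependent ℝ v)
    (hlam : ∀ i j, lam i (v j) = if i = j then 1 else 0) (x : Fin n → ℝ) :
    (∑ i, lam i x = 1) ∧ x = ∑ i, lam i x • v i := by
  have hs : affineSpan ℝ (Set.range v) = ⊤ := by
    rw [hv.affineSpan_eq_top_iff_card_eq_finrank_add_one]; simp
  let b : AffineBasis (Fin (n + 1)) ℝ (Fin n → ℝ) := ⟨v, hv, hs⟩
  have h1 : ∑ i, b.coord i x • v i = x := b.linear_combination_coord_eq_self x
  have h2 : ∑ i, b.coord i x = 1 := b.sum_coord_apply_eq_one x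
  have h3 : ∀ i, lam i x = b.coord i x := by
    intro i
    have e1 : x = (∑ j, b.coord j x • (v j - v (Fin.last n))) +ᵥ v (Fin.last n) := by
      simp_rw [smul_sub, Finset.sum_sub_distrib, ← Finset.sum_smul, h1, h2]; simp
    rw [e1, AffineMap.map_vadd, map_sum, ← e1]
    have e2 : ∀ j, (lam i).linear (b.coord j x • (v j - v (Fin.last n))) =
        b.coord j x * (if i = j then 1 else 0) - b.coord j x * lam i (v (Fin.last n)) := by
      intro j
      have := (lam i).linearMap_vsub (v j) (v (Fin.last n))
      simp only [vsub_eq_sub] at this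
      rw [map_smul, this, smul_eq_mul, hlam i j, mul_sub]
    simp_rw [e2, Finset.sum_sub_distrib, ← Finset.sum_mul, h2]
    simp
  simp_rw [h3]
  exact ⟨h2, h1.symm⟩

lemma bary_point' (hv : AffineIndependent ℝ v)
    (hlam : ∀ i j, lam i (v j) = if i = j then 1 else 0) (x : Fin n → ℝ) :
    x = v (Fin.last n) + ∑ i, lam i x • (v i - v (Fin.last n)) := by
  obtain ⟨h1, h2⟩ := bary_point hv hlam x
  simp_rw [smul_sub, Finset.sum_sub_distrib, ← Finset.sum_smul, h1, ← h2]; simp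

lemma bary_vec (hv : AffineIndependent ℝ v)
    (hlam : ∀ i j, lam i (v j) = if i = j then 1 else 0) (U : Fin n → ℝ) :
    U = ∑ i, (lam i).linear U • (v i - v (Fin.last n)) := by
  have h := bary_point' hv hlam (U +ᵥ v (Fin.last n))
  simp_rw [AffineMap.map_vadd, hlam] at h
  simp only [vadd_eq_add, add_smul, Finset.sum_add_distrib] at h
  simp only [ite_smul, one_smul, zero_smul] at h
  rw [add_comm] at h
  simpa using h

lemma alt_eq_zero (hv : AffineIndependent ℝ v)
    (hlam : ∀ i j, lam i (v j) = if i = j then 1 else 0)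
    (a : (Fin n → ℝ) [⋀^Fin k]→ₗ[ℝ] ℝ) (h : ∀ t : Fin k → Fin (n + 1), a (fun j => v (t j) - v (Fin.last n)) = 0)
    (U : Fin k → Fin n → ℝ) : a U = 0 := by
  have e : U = fun j => ∑ i, (lam i).linear (U j) • (v i - v (Fin.last n)) :=
    funext fun j => bary_vec hv hlam (U j)
  rw [e]
  have h1 := a.toMultilinearMap.map_sum (fun (j : Fin k) (i : Fin (n + 1)) => (lam i).linear (U j) • (v i - v (Fin.last n)))
  refine h1.trans (Finset.sum_eq_zero fun t _ => ?_)
  rw [MultilinearMap.map_smul_univ]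
  have := h t
  change _ • a _ = _
  rw [this, smul_zero]

lemma inj_pos (hr : 1 ≤ r) (hv : AffineIndependent ℝ v)
    (hlam : ∀ i j, lam i (v j) = if i = j then 1 else 0) {ω : Form n (k + 1)} (hω : Good r ω)
    (W : ∀ q : MinIdx n (k + 1) r, simpIntegral ω (smallSimplex v r q.val.1 q.val.2) = 0) : ω = 0 := by
  have h0 := face_all hr hω W
  ext x U
  obtain ⟨a, ha⟩ := hω.alt x
  rw [ha]
  refine alt_eq_zero hv hlam a (fun t => ?_) U
  rw [← ha, bary_point' hv hlam x]
  exact h0 (fun i => lam i x) (fun i hi => absurd hi (Nat.not_lt_zero _)) t (fun j => Nat.zero_le _)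

end Cpart7

section Cpart8
variable {n r : ℕ}

lemma simpIntegral_zero (ω : Form n 0) (p : Fin 1 → Fin n → ℝ) :
    simpIntegral ω p = ω (p 0) (fun j => j.elim0) := by
  unfold simpIntegral
  have h1 : stdSimplexSet 0 = Set.univ := by ext x; simp [stdSimplexSet]
  rw [h1, Measure.restrict_univ, integral_unique]
  have h2 : (volume : Measure (Fin 0 → ℝ)).real Set.univ = 1 := by
    rw [volume_pi, Measure.pi_of_empty (x := fun j => j.elim0)]; simp
  rw [h2, one_smul]
  simp only [Finset.univ_eq_empty, Finset.sum_empty, add_zero]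
  congr 1
  ext j; exact j.elim0

lemma lattice_zero (hr : 1 ≤ r) {v : Fin (n + 1) → Fin n → ℝ} {ω : Form n 0}
    (W : ∀ q : MinIdx n 0 r, simpIntegral ω (smallSimplex v r q.val.1 q.val.2) = 0)
    (b : Fin (n + 1) → ℕ) (hb : ∑ i, b i = r) :
    ω ((r : ℝ)⁻¹ • ∑ i, (b i : ℝ) • v i) (fun j => j.elim0) = 0 := by
  classical
  have hne : (Finset.univ.filter (fun i => b i ≠ 0)).Nonempty := by
    by_contra h
    rw [Finset.not_nonempty_iff_eq_empty, Finset.filter_eq_empty_iff] at h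
    have : ∑ i, b i = 0 := Finset.sum_eq_zero fun i hi => by simpa using h hi
    omega
  set m := (Finset.univ.filter (fun i => b i ≠ 0)).min' hne with hm
  have hm1 : b m ≠ 0 := by
    have := Finset.min'_mem _ hne
    simpa using this
  have hm2 : ∀ i < m, b i = 0 := by
    intro i hi
    by_contra h
    exact absurd (Finset.min'_le _ i (by simpa using h)) (not_le.2 hi)
  have hbs : ∀ i, b i = (b i - if i = m then 1 else 0) + if i = m then 1 else 0 := by
    intro i
    by_cases h : i = m
    · subst h; simp; omega
    · simp [h]
  have hs : ∑ i, (b i - if i = m then 1 else 0) = r - 1 := by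
    have : ∑ i, b i = ∑ i, (b i - if i = m then 1 else 0) + 1 := by
      conv_lhs => rw [Finset.sum_congr rfl fun i _ => hbs i]
      rw [Finset.sum_add_distrib]; simp
    omega
  have h := W ⟨(fun _ => m, fun i => b i - if i = m then 1 else 0), @Subsingleton.strictMono (Fin 1) _ _ _ _ _, hs,
    fun i hi => by simp [hm2 i hi]⟩
  rw [simpIntegral_zero] at h
  rw [← h]
  congr 1
  unfold smallSimplex
  congr 1
  have : ∀ i, (b i : ℝ) • v i = (if i = m then v i else 0) + ((b i - if i = m then 1 else 0 : ℕ) : ℝ) • v i := by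
    intro i
    conv_lhs => rw [hbs i]
    push_cast
    by_cases h : i = m
    · simp [h]; module
    · simp [h]
  rw [Finset.sum_congr rfl fun i _ => this i, Finset.sum_add_distrib]
  simp

lemma inj_zero (hr : 1 ≤ r) {v : Fin (n + 1) → Fin n → ℝ} {lam : Fin (n + 1) → ((Fin n → ℝ) →ᵃ[ℝ] ℝ)}
    (hv : AffineIndependent ℝ v)
    (hlam : ∀ i j, lam i (v j) = if i = j then 1 else 0) {ω : Form n 0} (hω : Good r ω)
    (W : ∀ q : MinIdx n 0 r, simpIntegral ω (smallSimplex v r q.val.1 q.val.2) = 0) : ω = 0 := by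
  have hr0 : (r : ℝ) ≠ 0 := by positivity
  obtain ⟨p, hp, hp'⟩ := hω.poly (fun j => j.elim0)
  obtain ⟨P, hP, hP'⟩ := PR_pullback (ι := Fin n) p hp (v (Fin.last n)) 0
    (fun i => (r : ℝ)⁻¹ • (v i.castSucc - v (Fin.last n)))
  set q := MvPolynomial.map (Polynomial.evalRingHom (0 : ℝ)) P with hq
  have hq' : ∀ x : Fin n → ℝ, MvPolynomial.eval x q =
      ω (v (Fin.last n) + ∑ i, x i • (r : ℝ)⁻¹ • (v i.castSucc - v (Fin.last n))) (fun j => j.elim0) := by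
    intro x
    have := hP' 0 x
    rw [hp']
    refine this.symm.trans ?_
    simp
  have hdeg : ∀ β, r < Finsupp.degree β → q.coeff β = 0 := by
    intro β hβ
    rw [hq, MvPolynomial.coeff_map]
    have : P.coeff β = 0 := by ext j; exact hP β j (by omega)
    rw [this, map_zero]
  have hval : ∀ η : Fin n → ℕ, ∑ i, η i ≤ r → MvPolynomial.eval (fun i => (η i : ℝ)) q = 0 := by
    intro η hη
    rw [hq', ← lattice_zero hr W (Fin.snoc η (r - ∑ i, η i) : Fin (n + 1) → ℕ) (by
      rw [Fin.sum_univ_castSucc]; simp; omega)]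
    congr 1
    rw [eq_inv_smul_iff₀ hr0, Fin.sum_univ_castSucc]
    simp only [Fin.snoc_castSucc, Fin.snoc_last]
    rw [Nat.cast_sub hη, smul_add, Finset.smul_sum]
    have : ∀ i, (r : ℝ) • ((η i : ℝ) • (r : ℝ)⁻¹ • (v i.castSucc - v (Fin.last n))) =
        (η i : ℝ) • v i.castSucc - (η i : ℝ) • v (Fin.last n) := by
      intro i
      rw [smul_comm, smul_inv_smul₀ hr0, smul_sub]
    simp_rw [this, Finset.sum_sub_distrib, ← Finset.sum_smul]
    push_cast
    module
  have hcoef : ∀ d e : ℕ, e + d = r + 1 → ∀ γ : Fin n →₀ ℕ, e ≤ γ.degree → q.coeff γ = 0 := by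
    intro d
    induction d with
    | zero => intro e he γ hγ; exact hdeg γ (by omega)
    | succ d ih =>
      intro e he γ hγ
      by_cases h : e + 1 ≤ γ.degree
      · exact ih (e + 1) (by omega) γ h
      · obtain ⟨S, w, h1, h2⟩ := exists_coeff_functional γ
        rw [← h2 q (fun β hβ => ih (e + 1) (by omega) β (by omega))]
        refine Finset.sum_eq_zero fun η hη => ?_
        rw [hval η ((h1 η hη).trans (by omega)), mul_zero]
  have hq0 : q = 0 := by
    ext γ
    exact hcoef (r + 1) 0 (by omega) γ (by omega)
  ext x U
  have hU : U = fun j => j.elim0 := by ext j; exact j.elim0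
  subst hU
  have h3 := hq' (fun i => r * lam i.castSucc x)
  rw [hq0, map_zero] at h3
  have h4 : v (Fin.last n) + ∑ i : Fin n, (r * lam i.castSucc x) • (r : ℝ)⁻¹ • (v i.castSucc - v (Fin.last n)) = x := by
    conv_rhs => rw [bary_point' hv hlam x]
    rw [Fin.sum_univ_castSucc]
    simp only [sub_self, smul_zero, add_zero]
    congr 1
    refine Finset.sum_congr rfl fun i _ => ?_
    rw [smul_smul]; congr 1; field_simp
  rw [h4] at h3
  exact h3.symm

end Cpart8

section Dpart1
variable {n k r : ℕ}

instance MinIdx_finite (n k r : ℕ) : Finite (MinIdx n k r) := by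
  let F : MinIdx n k r → (Fin (k + 1) → Fin (n + 1)) × (Fin (n + 1) → Fin (r + 1)) := fun q =>
    (q.val.1, fun i => ⟨q.val.2 i, by
      have h1 := q.2.2.1
      have h2 := Finset.single_le_sum (f := q.val.2) (fun i _ => Nat.zero_le _) (Finset.mem_univ i)
      omega⟩)
  refine Finite.of_injective F fun p q h => ?_
  have h1 := congrArg Prod.fst h
  have h2 := congrArg Prod.snd h
  apply Subtype.ext
  refine Prod.ext (show p.val.1 = q.val.1 from h1) ?_
  ext i
  have := congrFun h2 i
  simpa [F] using this

variable {v : Fin (n + 1) → Fin n → ℝ} {lam : Fin (n + 1) → ((Fin n → ℝ) →ᵃ[ℝ] ℝ)}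

lemma lam_comb (hlam : ∀ i j, lam i (v j) = if i = j then 1 else 0) (y : Fin (n + 1) → ℝ) (hy : ∑ i, y i = 1)
    (i : Fin (n + 1)) : lam i (∑ j, y j • v j) = y i := by
  have e1 : ∑ j, y j • v j = (∑ j, y j • (v j - v (Fin.last n))) +ᵥ v (Fin.last n) := by
    simp_rw [smul_sub, Finset.sum_sub_distrib, ← Finset.sum_smul, hy]; simp
  rw [e1, AffineMap.map_vadd, map_sum]
  have e2 : ∀ j, (lam i).linear (y j • (v j - v (Fin.last n))) =
      y j * (if i = j then 1 else 0) - y j * lam i (v (Fin.last n)) := by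
    intro j
    have := (lam i).linearMap_vsub (v j) (v (Fin.last n))
    simp only [vsub_eq_sub] at this
    rw [map_smul, this, smul_eq_mul, hlam i j, mul_sub]
  simp_rw [e2, Finset.sum_sub_distrib, ← Finset.sum_mul, hy]
  simp

lemma whitney_test (hlam : ∀ i j, lam i (v j) = if i = j then 1 else 0) (y : Fin (n + 1) → ℝ) (hy : ∑ i, y i = 1)
    (σ τ : Fin (k + 1) → Fin (n + 1)) :
    whitney lam σ (∑ j, y j • v j) (fun b => v (τ b.succ) - ∑ j, y j • v j) =
      Matrix.det (Matrix.of fun j i : Fin (k + 1) =>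
        (Fin.cons (y (σ i)) (fun b => if σ i = τ b.succ then 1 else 0) : Fin (k + 1) → ℝ) j) := by
  rw [whitney_det]
  refine Matrix.det_eq_of_forall_row_eq_smul_add_const (fun j => if j = 0 then 0 else -1) 0 (by simp) ?_
  intro j i
  refine Fin.cases ?_ (fun b => ?_) j
  · simp [lam_comb hlam y hy]
  · have := (lam (σ i)).linearMap_vsub (v (τ b.succ)) (∑ j, y j • v j)
    simp only [vsub_eq_sub] at this
    simp only [Matrix.of_apply, Fin.cons_succ, Fin.cons_zero]
    rw [this, hlam, lam_comb hlam y hy]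
    simp; ring

lemma whitney_test_lt (hlam : ∀ i j, lam i (v j) = if i = j then 1 else 0) (y : Fin (n + 1) → ℝ) (hy : ∑ i, y i = 1)
    (σ τ : Fin (k + 1) → Fin (n + 1)) (hτ : StrictMono τ) (hy0 : ∀ i < τ 0, y i = 0) (h : σ 0 < τ 0) :
    whitney lam σ (∑ j, y j • v j) (fun b => v (τ b.succ) - ∑ j, y j • v j) = 0 := by
  rw [whitney_test hlam y hy]
  refine Matrix.det_eq_zero_of_column_eq_zero 0 fun j => ?_
  refine Fin.cases ?_ (fun b => ?_) j
  · simp [hy0 _ h]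
  · have : σ 0 ≠ τ b.succ := (h.trans (hτ (Fin.succ_pos b))).ne
    simp [this]

lemma whitney_test_self (hlam : ∀ i j, lam i (v j) = if i = j then 1 else 0) (y : Fin (n + 1) → ℝ) (hy : ∑ i, y i = 1)
    (τ : Fin (k + 1) → Fin (n + 1)) (hτ : StrictMono τ) :
    whitney lam τ (∑ j, y j • v j) (fun b => v (τ b.succ) - ∑ j, y j • v j) = y (τ 0) := by
  rw [whitney_test hlam y hy, Matrix.det_of_isUpperTriangular]
  · rw [Fin.prod_univ_succ]; simp
  · intro j i hij
    simp only [id] at hij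
    induction j using Fin.cases with
    | zero => exact absurd hij (Fin.not_lt_zero _)
    | succ b =>
      have : τ i ≠ τ b.succ := (hτ hij).ne
      simp [this]

lemma whitney_test_ne (hlam : ∀ i j, lam i (v j) = if i = j then 1 else 0) (y : Fin (n + 1) → ℝ) (hy : ∑ i, y i = 1)
    (σ τ : Fin (k + 1) → Fin (n + 1)) (hσ : StrictMono σ) (hτ : StrictMono τ) (h : σ 0 = τ 0) (hne : σ ≠ τ) :
    whitney lam σ (∑ j, y j • v j) (fun b => v (τ b.succ) - ∑ j, y j • v j) = 0 := by
  rw [whitney_test hlam y hy]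
  have : ∃ b, ∀ a, σ a ≠ τ b := by
    by_contra hc
    push Not at hc
    apply hne
    have h1 : Set.range τ ⊆ Set.range σ := by
      rintro _ ⟨b, rfl⟩
      exact hc b
    have h2 : Set.range τ = Set.range σ := by
      refine Set.eq_of_subset_of_ncard_le h1 ?_ (Set.toFinite _)
      rw [← Set.image_univ, ← Set.image_univ, Set.ncard_image_of_injective _ hσ.injective,
        Set.ncard_image_of_injective _ hτ.injective]
    exact ((StrictMono.range_inj hτ hσ).1 h2).symm
  obtain ⟨b, hb⟩ := this
  induction b using Fin.cases with
  | zero => exact absurd h (hb 0)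
  | succ b =>
    refine Matrix.det_eq_zero_of_row_eq_zero b.succ fun i => ?_
    simp [hb i]

lemma scaled_mem (hr : 1 ≤ r) (lam : Fin (n + 1) → ((Fin n → ℝ) →ᵃ[ℝ] ℝ)) (q : MinIdx n k r) :
    scaledWhitney lam q.val.2 q.val.1 ∈ PrMinus n k r lam := by
  apply Submodule.subset_span
  choose p hp hp' using fun i => lam_poly (lam i)
  refine ⟨∏ i, p i ^ q.val.2 i, q.val.1, q.2.1, ?_, ?_⟩
  · refine (MvPolynomial.totalDegree_finsetProd _ _).trans ?_
    refine le_trans ?_ q.2.2.1.le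
    refine Finset.sum_le_sum fun i _ => ?_
    refine (MvPolynomial.totalDegree_pow _ _).trans ?_
    have := Nat.mul_le_mul_left (q.val.2 i) (hp i)
    simpa using this
  · ext x u
    simp [scaledWhitney, hp']

lemma scaled_indep (hlam : ∀ i j, lam i (v j) = if i = j then 1 else 0) [Fintype (MinIdx n k r)]
    (c : MinIdx n k r → ℝ) (hc : ∑ q, c q • scaledWhitney lam q.val.2 q.val.1 = 0) : c = 0 := by
  classical
  have hcx : ∀ x u, ∑ q, c q * ((∏ i, lam i x ^ q.val.2 i) * whitney lam q.val.1 x u) = 0 := by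
    intro x u
    have := congrFun (congrFun hc x) u
    simpa [Finset.sum_apply, scaledWhitney] using this
  suffices H : ∀ d m : ℕ, m + d = n + 1 → ∀ q : MinIdx n k r, m ≤ (q.val.1 0 : ℕ) → c q = 0 by
    ext q
    exact H (n + 1) 0 (by omega) q (by omega)
  intro d
  induction d with
  | zero =>
    intro m hm q hq
    have := (q.val.1 0).2
    omega
  | succ d ih =>
    intro m hm q0 hq0
    by_cases hlt : m + 1 ≤ (q0.val.1 0 : ℕ)
    · exact ih (m + 1) (by omega) q0 hlt
    have hm0 : (q0.val.1 0 : ℕ) = m := by omega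
    set τ := q0.val.1 with hτ
    have hτm : StrictMono τ := q0.2.1
    let Q : MvPolynomial (Fin (n + 1)) ℝ := ∑ q : MinIdx n k r, if q.val.1 = τ then
      MvPolynomial.monomial (Finsupp.equivFunOnFinite.symm q.val.2) (c q) else 0
    have hQ : ∀ z, MvPolynomial.eval z Q = ∑ q : MinIdx n k r, if q.val.1 = τ then c q * ∏ i, z i ^ q.val.2 i else 0 := by
      intro z
      simp only [Q, map_sum, apply_ite (MvPolynomial.eval z), map_zero]
      refine Finset.sum_congr rfl fun q _ => ?_
      congr 1
      rw [MvPolynomial.eval_monomial, Finsupp.prod_fintype _ _ (by simp)]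
      simp
    have hQ0 : Q = 0 := by
      refine MvPolynomial.funext_set (fun _ => Set.Ioi (0 : ℝ)) (fun _ => Set.Ioi_infinite 0) fun z hz => ?_
      have hz' : ∀ i, 0 < z i := fun i => by simpa using hz i (Set.mem_univ i)
      set y0 : Fin (n + 1) → ℝ := fun i => if i < τ 0 then 0 else z i with hy0
      set s := ∑ i, y0 i with hs
      have hspos : 0 < s := by
        refine Finset.sum_pos' (fun i _ => ?_) ⟨τ 0, Finset.mem_univ _, ?_⟩
        · simp only [hy0]; split_ifs
          · exact le_rfl
          · exact (hz' i).le
        · simp [hy0, hz']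
      set y : Fin (n + 1) → ℝ := fun i => s⁻¹ * y0 i with hy
      have hy1 : ∑ i, y i = 1 := by
        rw [hy, ← Finset.mul_sum, ← hs]; field_simp
      have hyz : ∀ i < τ 0, y i = 0 := fun i hi => by simp [hy, hy0, hi]
      have h1 := hcx (∑ j, y j • v j) (fun b => v (τ b.succ) - ∑ j, y j • v j)
      simp only [lam_comb hlam y hy1] at h1
      rw [hQ, map_zero]
      have h2 : ∀ q : MinIdx n k r, c q * ((∏ i, y i ^ q.val.2 i) *
          whitney lam q.val.1 (∑ j, y j • v j) (fun b => v (τ b.succ) - ∑ j, y j • v j)) =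
          (s⁻¹ ^ (r - 1) * y (τ 0)) * (if q.val.1 = τ then c q * ∏ i, z i ^ q.val.2 i else 0) := by
        intro q
        by_cases hq : q.val.1 = τ
        · rw [if_pos hq, hq, whitney_test_self hlam y hy1 τ hτm]
          have h3 : ∏ i, y i ^ q.val.2 i = s⁻¹ ^ (r - 1) * ∏ i, z i ^ q.val.2 i := by
            have h4 : s⁻¹ ^ (r - 1) = s⁻¹ ^ (∑ i, q.val.2 i) := by congr 1; exact q.2.2.1.symm
            rw [h4, ← Finset.prod_pow_eq_pow_sum, ← Finset.prod_mul_distrib]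
            refine Finset.prod_congr rfl fun i _ => ?_
            by_cases hi : i < τ 0
            · rw [q.2.2.2 i (by rw [hq]; exact hi)]; simp
            · simp only [hy, hy0, if_neg hi]; rw [mul_pow]
          rw [h3]; ring
        · rw [if_neg hq, mul_zero]
          rcases lt_trichotomy (q.val.1 0) (τ 0) with h | h | h
          · rw [whitney_test_lt hlam y hy1 _ τ hτm hyz h]; simp
          · rw [whitney_test_ne hlam y hy1 _ τ q.2.1 hτm h hq]; simp
          · rw [ih (m + 1) (by omega) q (by rw [Fin.lt_def] at h; omega), zero_mul]
      rw [Finset.sum_congr rfl fun q _ => h2 q, ← Finset.mul_sum] at h1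
      refine (mul_eq_zero.1 h1).resolve_left ?_
      have : 0 < y (τ 0) := by simp only [hy, hy0, lt_irrefl, if_false]; exact mul_pos (inv_pos.2 hspos) (hz' _)
      positivity
    have h5 := congrArg (MvPolynomial.coeff (Finsupp.equivFunOnFinite.symm q0.val.2)) hQ0
    simp only [Q, MvPolynomial.coeff_sum, MvPolynomial.coeff_zero] at h5
    rw [Finset.sum_eq_single q0] at h5
    · simpa [hτ] using h5
    · intro q _ hq
      split_ifs with h
      · rw [MvPolynomial.coeff_monomial, if_neg]
        intro h6
        apply hq
        apply Subtype.ext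
        exact Prod.ext h (Finsupp.equivFunOnFinite.symm.injective h6)
      · simp
    · simp

end Dpart1

section Epart1

lemma card_strictMono (k N : ℕ) : Nat.card {σ : Fin k → Fin N // StrictMono σ} = N.choose k := by
  have e : {σ : Fin k → Fin N // StrictMono σ} ≃ (Fin k ↪o Fin N) :=
    { toFun := fun σ => OrderEmbedding.ofStrictMono σ.1 σ.2
      invFun := fun f => ⟨f, f.strictMono⟩
      left_inv := fun σ => rfl
      right_inv := fun f => by ext; rfl }
  rw [Nat.card_congr (e.trans Set.powersetCard.ofFinEmbEquiv), Set.powersetCard.card]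
  simp

lemma card_multi (N s : ℕ) : Nat.card {P : Fin (N + 1) → ℕ // ∑ i, P i = s} = (N + s).choose s := by
  rw [← Nat.card_congr (Sym.equivNatSumOfFintype (Fin (N + 1)) s), Nat.card_eq_fintype_card,
    Sym.card_sym_eq_choose, Fintype.card_fin]
  congr 1
  omega

/-- raising all vertices by one -/
def shiftIdx (n k r : ℕ) (q : MinIdx n k r) : MinIdx (n + 1) k r :=
  ⟨(fun j => (q.val.1 j).succ, Fin.cons 0 q.val.2), fun i j h => Fin.succ_lt_succ_iff.2 (q.2.1 h), by
    rw [Fin.sum_univ_succ]; simpa using q.2.2.1, fun i hi => by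
    induction i using Fin.cases with
    | zero => simp
    | succ i => simpa using q.2.2.2 i (by simpa using hi)⟩

/-- indices starting with the vertex `0` -/
def consIdx (n k r : ℕ) (p : {σ : Fin k → Fin (n + 1) // StrictMono σ} ×
    {P : Fin (n + 1 + 1) → ℕ // ∑ i, P i = r - 1}) : MinIdx (n + 1) k r :=
  ⟨(Fin.cons 0 (fun j => (p.1.1 j).succ), p.2.1), by
    intro i j h
    induction j using Fin.cases with
    | zero => exact absurd h (Fin.not_lt_zero _)
    | succ j =>
      induction i using Fin.cases with
      | zero => simp
      | succ i => simpa using p.1.2 (Fin.succ_lt_succ_iff.1 h), p.2.2, fun i hi => by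
    simp at hi⟩

lemma glue_bij (n k r : ℕ) : Function.Bijective (Sum.elim (shiftIdx n k r) (consIdx n k r)) := by
  have h0 : ∀ p, (consIdx n k r p).val.1 0 = 0 := fun p => by simp [consIdx]
  have h1 : ∀ p, (shiftIdx n k r p).val.1 0 ≠ 0 := fun p => by simp [shiftIdx]
  constructor
  · rintro (p | p) (q | q) h
    · congr 1
      have h2 := congrArg (fun z => z.val.1) h
      have h3 := congrArg (fun z => z.val.2) h
      apply Subtype.ext
      refine Prod.ext (funext fun j => ?_) (funext fun i => ?_)
      · have := congrFun h2 j
        simpa [shiftIdx] using this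
      · have := congrFun h3 i.succ
        simpa [shiftIdx] using this
    · exact absurd ((congrArg (fun z => z.val.1 0) h).trans (h0 q)) (h1 p)
    · exact absurd ((congrArg (fun z => z.val.1 0) h).symm.trans (h0 p)) (h1 q)
    · congr 1
      have h2 := congrArg (fun z => z.val.1) h
      have h3 := congrArg (fun z => z.val.2) h
      refine Prod.ext (Subtype.ext (funext fun j => ?_)) (Subtype.ext h3)
      have := congrFun h2 j.succ
      simpa [consIdx] using this
  · intro q
    by_cases hq : q.val.1 0 = 0
    · have hne : ∀ j : Fin k, q.val.1 j.succ ≠ 0 := fun j h => by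
        have := q.2.1 (Fin.succ_pos j)
        rw [h] at this
        exact absurd this (Fin.not_lt_zero _)
      refine ⟨Sum.inr (⟨fun j => (q.val.1 j.succ).pred (hne j), fun i j h => ?_⟩, ⟨q.val.2, q.2.2.1⟩), ?_⟩
      · rw [Fin.pred_lt_pred_iff]; exact q.2.1 (Fin.succ_lt_succ_iff.2 h)
      · apply Subtype.ext
        refine Prod.ext (funext fun j => ?_) rfl
        induction j using Fin.cases with
        | zero => simp [consIdx, hq]
        | succ j => simp [consIdx]
    · have hpos : ∀ j, q.val.1 j ≠ 0 := fun j h => by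
        have := q.2.1.monotone (Fin.zero_le j)
        rw [h] at this
        exact hq (le_antisymm this (Fin.zero_le _))
      have hz : q.val.2 0 = 0 := q.2.2.2 0 (Fin.pos_of_ne_zero hq)
      refine ⟨Sum.inl ⟨(fun j => (q.val.1 j).pred (hpos j), fun i => q.val.2 i.succ), fun i j h => ?_, ?_, fun i hi => ?_⟩, ?_⟩
      · rw [Fin.pred_lt_pred_iff]; exact q.2.1 h
      · have := q.2.2.1
        rw [Fin.sum_univ_succ, hz, zero_add] at this
        exact this
      · refine q.2.2.2 i.succ ?_
        have h5 : i.succ < ((q.val.1 0).pred (hpos 0)).succ := Fin.succ_lt_succ_iff.2 hi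
        rwa [Fin.succ_pred] at h5
      · apply Subtype.ext
        refine Prod.ext (funext fun j => ?_) (funext fun i => ?_)
        · exact Fin.succ_pred _ (hpos j)
        · induction i using Fin.cases with
          | zero => exact hz.symm
          | succ i => rfl

lemma card_succ (n k r : ℕ) : Nat.card (MinIdx (n + 1) k r) =
    Nat.card (MinIdx n k r) + (n + 1).choose k * (n + 1 + (r - 1)).choose (r - 1) := by
  haveI : Finite {P : Fin (n + 1 + 1) → ℕ // ∑ i, P i = r - 1} :=
    Finite.of_equiv _ (Sym.equivNatSumOfFintype (Fin (n + 1 + 1)) (r - 1))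
  rw [← Nat.card_congr (Equiv.ofBijective _ (glue_bij n k r)), Nat.card_sum, Nat.card_prod, card_strictMono, card_multi]

lemma card_zero (k r : ℕ) : Nat.card (MinIdx 0 k (r + 1)) = if k = 0 then 1 else 0 := by
  split_ifs with h
  · subst h
    have : Unique (MinIdx 0 0 (r + 1)) :=
      { default := ⟨(fun _ => 0, fun _ => r), @Subsingleton.strictMono (Fin 1) _ _ _ _ _, by simp, fun i hi => by simp at hi⟩
        uniq := by
          intro q
          apply Subtype.ext
          refine Prod.ext (funext fun j => ?_) (funext fun i => ?_)
          · exact @Subsingleton.elim (Fin 1) _ _ _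
          · have := q.2.2.1
            have hi : i = 0 := @Subsingleton.elim (Fin 1) _ _ _
            subst hi
            simpa using this }
    exact Nat.card_unique
  · have : IsEmpty (MinIdx 0 k (r + 1)) := ⟨fun q => by
      have h1 : (0 : Fin (k + 1)) < Fin.last k := by rw [Fin.lt_def]; simp; omega
      have h2 := q.2.1 h1
      rw [Fin.lt_def] at h2
      have := (q.val.1 (Fin.last k)).2
      omega⟩
    simp

lemma card_MinIdx (n k r : ℕ) : Nat.card (MinIdx n k (r + 1)) = (r + k).choose k * (n + r + 1).choose (r + 1 + k) := by
  induction n with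
  | zero =>
    rw [card_zero]
    split_ifs with h
    · subst h; simp
    · rw [Nat.choose_eq_zero_of_lt (n := 0 + r + 1) (by omega)]; simp
  | succ n ih =>
    rw [card_succ, ih]
    have h1 := Nat.choose_mul (n := n + 1 + r) (k := r + k) (s := r) (by omega)
    have h2 : (r + k).choose r = (r + k).choose k := Nat.choose_symm_add
    rw [show n + 1 + r - r = n + 1 by omega, show r + k - r = k by omega, h2] at h1
    rw [show r + 1 - 1 = r by omega, mul_comm ((n + 1).choose k), ← h1, mul_comm ((n + 1 + r).choose _), ← mul_add,
      show n + 1 + r + 1 = (n + 1 + r) + 1 by rfl, show r + 1 + k = (r + k) + 1 by omega, Nat.choose_succ_succ' (n + 1 + r),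
      show n + r + 1 = n + 1 + r by omega, add_comm ((n + 1 + r).choose (r + k + 1))]

/-- the cardinality claim -/
lemma card_claim {n k r : ℕ} (hk : k ≤ n) (hr : 1 ≤ r) :
    Nat.card (MinIdx n k r) = (r + k - 1).choose k * (n + r).choose (n - k) := by
  obtain ⟨r, rfl⟩ : ∃ s, r = s + 1 := ⟨r - 1, by omega⟩
  rw [card_MinIdx, show r + 1 + k - 1 = r + k by omega, show n + (r + 1) = n + r + 1 by omega]
  congr 1
  exact Nat.choose_symm_of_eq_add (by omega)

end Epart1

section Fpart1
variable {n k r : ℕ}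

lemma Good.integrable {ω : Form n k} (h : Good r ω) (p : Fin (k + 1) → Fin n → ℝ) :
    IntegrableOn (fun x => ω (p 0 + ∑ j : Fin k, x j • (p j.succ - p 0)) (fun j => p j.succ - p 0)) (stdSimplexSet k) := by
  apply integrableOn_sS
  exact (h.continuous _).comp (by fun_prop)

/-- the map of weights -/
def weightMap (hr : 1 ≤ r) (v : Fin (n + 1) → Fin n → ℝ) (lam : Fin (n + 1) → ((Fin n → ℝ) →ᵃ[ℝ] ℝ)) :
    PrMinus n k r lam →ₗ[ℝ] (MinIdx n k r → ℝ) where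
  toFun ω q := simpIntegral ω.val (smallSimplex v r q.val.1 q.val.2)
  map_add' ω η := by
    ext q
    exact integral_add ((PrMinus_good hr lam ω.2).integrable _) ((PrMinus_good hr lam η.2).integrable _)
  map_smul' c ω := by
    ext q
    exact integral_const_mul _ _

lemma weightMap_injective (hr : 1 ≤ r) {v : Fin (n + 1) → Fin n → ℝ} (hv : AffineIndependent ℝ v)
    {lam : Fin (n + 1) → ((Fin n → ℝ) →ᵃ[ℝ] ℝ)} (hlam : ∀ i j, lam i (v j) = if i = j then 1 else 0) :
    Function.Injective (weightMap (k := k) hr v lam) := by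
  rw [injective_iff_map_eq_zero]
  intro ω hω
  have W : ∀ q : MinIdx n k r, simpIntegral ω.val (smallSimplex v r q.val.1 q.val.2) = 0 := fun q => congrFun hω q
  apply Subtype.ext
  have hg := PrMinus_good hr lam ω.2
  cases k with
  | zero => exact inj_zero hr hv hlam hg W
  | succ k => exact inj_pos hr hv hlam hg W

lemma weightMap_surjective (hr : 1 ≤ r) {v : Fin (n + 1) → Fin n → ℝ} (hv : AffineIndependent ℝ v)
    {lam : Fin (n + 1) → ((Fin n → ℝ) →ᵃ[ℝ] ℝ)} (hlam : ∀ i j, lam i (v j) = if i = j then 1 else 0) :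
    Function.Surjective (weightMap (k := k) hr v lam) := by
  classical
  haveI : Fintype (MinIdx n k r) := Fintype.ofFinite _
  let b : MinIdx n k r → PrMinus n k r lam := fun q => ⟨scaledWhitney lam q.val.2 q.val.1, scaled_mem hr lam q⟩
  let C : (MinIdx n k r → ℝ) →ₗ[ℝ] PrMinus n k r lam := Fintype.linearCombination ℝ b
  have hC : Function.Injective C := by
    rw [injective_iff_map_eq_zero]
    intro c hc
    refine scaled_indep (v := v) hlam c ?_
    have h := congrArg (PrMinus n k r lam).subtype hc
    rw [map_zero] at h
    rw [← h]
    simp only [C, Fintype.linearCombination_apply, map_sum, map_smul]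
    rfl
  have hinj : Function.Injective ((weightMap hr v lam).comp C) := (weightMap_injective hr hv hlam).comp hC
  have hsurj := LinearMap.injective_iff_surjective.1 hinj
  exact Function.Surjective.of_comp (g := C) hsurj

end Fpart1

/-- (Unisolvence of the minimal set.) The weights on the minimal set
`X_{r,min}^k(T)` realise a linear isomorphism `P_r^- Λ^k(T) ≃ ℝ^N`, where
`N = binom(r+k−1,k)·binom(n+r,n−k)` is the cardinality of the index set of pairs
`(σ, α)` with `α ∈ I_σ`. -/
theorem minimal_set_unisolvent {n k r : ℕ} (hn : 1 ≤ n) (hk : k ≤ n) (hr : 1 ≤ r)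
    (v : Fin (n + 1) → (Fin n → ℝ)) (hv : AffineIndependent ℝ v)
    (lam : Fin (n + 1) → ((Fin n → ℝ) →ᵃ[ℝ] ℝ))
    (hlam : ∀ i j, lam i (v j) = if i = j then 1 else 0) :
    Nat.card (MinIdx n k r) = (r + k - 1).choose k * (n + r).choose (n - k) ∧
    ∃ e : PrMinus n k r lam ≃ₗ[ℝ] (MinIdx n k r → ℝ),
      ∀ (ω : PrMinus n k r lam) (q : MinIdx n k r),
        e ω q = simpIntegral ω.val (smallSimplex v r q.val.1 q.val.2) := by
  exact ⟨card_claim hk hr, LinearEquiv.ofBijective (weightMap hr v lam)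
    ⟨weightMap_injective hr hv hlam, weightMap_surjective hr hv hlam⟩, fun ω q => rfl⟩
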